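/- arXiv:2602.03831 — 2 statements merged into one kernel-verified Lean document; each statement's English description precedes it below -/
import Mathlib

section
/- Let μ be an isotropic log-concave probability measure on ℝ^n with density f, with n ≥ 3. Then the inradius of R_{6n}(μ) with respect to the origin satisfies r(R_{6n}(μ)) ≥ 1/3, i.e. (1/3)B₂ⁿ ⊆ R_{6n}(μ). -/
open MeasureTheory Metric Filter Set

noncomputable section

abbrev Euc (n : ℕ) := EuclideanSpace ℝ (Fin n)

/-- `f` is a log-concave (nonnegative) function on `ℝ^n`. -/
def IsLogConcaveFn {n : ℕ} (f : Euc n → ℝ) : Prop :=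
  (∀ x, 0 ≤ f x) ∧
  ∀ x y : Euc n, ∀ τ : ℝ, 0 ≤ τ → τ ≤ 1 →
    f x ^ τ * f y ^ (1 - τ) ≤ f (τ • x + (1 - τ) • y)

/-- The super-level set `R_t(μ) = {x : f x ≥ e^{-t} ‖f‖_∞}` of a density `f`. -/
def superLevelSet {n : ℕ} (f : Euc n → ℝ) (t : ℝ) : Set (Euc n) :=
  {x | Real.exp (-t) * essSup f volume ≤ f x}

open scoped Pointwise ENNReal


lemma bm_compact {A B C : Set ℝ} (hA : IsCompact A) (hB : IsCompact B)
    (hAn : A.Nonempty) (hBn : B.Nonempty) {l m : ℝ} (hl : 0 < l) (hm : 0 < m)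
    (h : ∀ x ∈ A, ∀ y ∈ B, l * x + m * y ∈ C) :
    ENNReal.ofReal l * volume A + ENNReal.ofReal m * volume B ≤ volume C := by
  obtain ⟨a, haA, ha⟩ := hA.exists_isGreatest hAn
  obtain ⟨b, hbB, hb⟩ := hB.exists_isLeast hBn
  have vol : ∀ (r c : ℝ) (_ : 0 < r) (S : Set ℝ),
      volume ((fun x => r * x + c) '' S) = ENNReal.ofReal r * volume S := by
    intro r c hr S
    have : (fun x => r * x + c) '' S = (fun x => x + c) '' (r • S) := by
      rw [← Set.image_smul, Set.image_image]; rfl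
    rw [this, Set.image_add_right, measure_preimage_add_right, Measure.addHaar_smul]
    simp [abs_of_pos hr]
  set S1 := (fun x => l * x + m * b) '' A with hS1
  set S2 := (fun y => m * y + l * a) '' B with hS2
  have h1 : volume S1 = _ := vol l (m * b) hl A
  have h2 : volume S2 = _ := vol m (l * a) hm B
  have hsub : S1 ∪ S2 ⊆ C := by
    rintro z (⟨x, hx, rfl⟩ | ⟨y, hy, rfl⟩)
    · exact h x hx b hbB
    · have := h a haA y hy
      simpa [add_comm] using this
  have hdis : AEDisjoint volume S1 S2 := by
    refine measure_mono_null (t := {l * a + m * b}) ?_ (by simp)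
    rintro z ⟨⟨x, hx, rfl⟩, ⟨y, hy, hxy⟩⟩
    have i1 := mul_le_mul_of_nonneg_left (ha hx) hl.le
    have i2 := mul_le_mul_of_nonneg_left (hb hy) hm.le
    simp only at hxy
    simp only [mem_singleton_iff]
    linarith
  have hS2m : MeasurableSet S2 := by
    have : IsCompact S2 := hB.image (by fun_prop)
    exact this.measurableSet
  calc _ = volume (S1 ∪ S2) := by
        rw [measure_union₀ hS2m.nullMeasurableSet hdis, h1, h2]
    _ ≤ _ := measure_mono hsub

lemma bm_one {A B C : Set ℝ} (hA : MeasurableSet A) (hB : MeasurableSet B)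
    (hAn : A.Nonempty) (hBn : B.Nonempty) {l m : ℝ} (hl : 0 < l) (hm : 0 < m)
    (h : ∀ x ∈ A, ∀ y ∈ B, l * x + m * y ∈ C) :
    ENNReal.ofReal l * volume A + ENNReal.ofReal m * volume B ≤ volume C := by
  obtain ⟨a, haA⟩ := hAn
  obtain ⟨b, hbB⟩ := hBn
  have key : ∀ K ⊆ A, IsCompact K → ∀ L ⊆ B, IsCompact L →
      ENNReal.ofReal l * volume K + ENNReal.ofReal m * volume L ≤ volume C := by
    intro K hK hKc L hL hLc
    refine le_trans ?_ (bm_compact (hKc.insert a) (hLc.insert b) (insert_nonempty _ _)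
      (insert_nonempty _ _) hl hm (C := C) ?_)
    · gcongr <;> exact subset_insert _ _
    · intro x hx y hy
      exact h x (insert_subset haA hK hx) y (insert_subset hbB hL hy)
  have hl0 : ENNReal.ofReal l ≠ 0 := by simpa using hl
  have hm0 : ENNReal.ofReal m ≠ 0 := by simpa using hm
  have step : ∀ L ⊆ B, IsCompact L →
      ENNReal.ofReal l * volume A + ENNReal.ofReal m * volume L ≤ volume C := by
    intro L hL hLc
    rw [hA.measure_eq_iSup_isCompact]
    simp only [ENNReal.mul_iSup]
    rw [ENNReal.iSup_add]
    refine iSup_le fun K => ?_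
    by_cases hK : K ⊆ A
    · by_cases hKc : IsCompact K
      · simpa [hK, hKc] using key K hK hKc L hL hLc
      · simpa [hK, hKc] using key ∅ (by simp) (by simp) L hL hLc
    · simpa [hK] using key ∅ (by simp) (by simp) L hL hLc
  rw [hB.measure_eq_iSup_isCompact]
  simp only [ENNReal.mul_iSup]
  rw [ENNReal.add_iSup]
  refine iSup_le fun K => ?_
  by_cases hK : K ⊆ B
  · by_cases hKc : IsCompact K
    · simpa [hK, hKc] using step K hK hKc
    · simpa [hK, hKc] using step ∅ (by simp) (by simp)
  · simpa [hK] using step ∅ (by simp) (by simp)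

lemma layer_enn {f : ℝ → ℝ≥0∞} (hf : Measurable f) (hfin : ∀ x, f x ≠ ⊤) :
    ∫⁻ x, f x = ∫⁻ s in Ioi (0:ℝ), volume {x | ENNReal.ofReal s < f x} := by
  have h := lintegral_eq_lintegral_meas_lt (volume : Measure ℝ) (f := fun x => (f x).toReal)
    (Eventually.of_forall fun x => ENNReal.toReal_nonneg) hf.ennreal_toReal.aemeasurable
  have h1 : ∀ x, ENNReal.ofReal (f x).toReal = f x := fun x => ENNReal.ofReal_toReal (hfin x)
  simp only [h1] at h
  rw [h]
  refine setLIntegral_congr_fun measurableSet_Ioi fun s hs => ?_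
  congr 1
  ext x
  exact (ENNReal.ofReal_lt_iff_lt_toReal (le_of_lt hs) (hfin x)).symm

lemma pl_norm {f g h : ℝ → ℝ≥0∞} (hf : Measurable f) (hg : Measurable g) (hh : Measurable h)
    (hf1 : ⨆ x, f x = 1) (hg1 : ⨆ x, g x = 1) {l m : ℝ} (hl : 0 < l) (hm : 0 < m)
    (hlm : l + m = 1)
    (H : ∀ x y, f x ^ l * g y ^ m ≤ h (l * x + m * y)) :
    ENNReal.ofReal l * (∫⁻ x, f x) + ENNReal.ofReal m * (∫⁻ x, g x) ≤ ∫⁻ x, h x := by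
  have fle : ∀ x, f x ≤ 1 := fun x => hf1 ▸ le_iSup f x
  have gle : ∀ x, g x ≤ 1 := fun x => hg1 ▸ le_iSup g x
  have hle : ∫⁻ x, min (h x) 1 ≤ ∫⁻ x, h x := lintegral_mono fun x => min_le_left _ _
  refine le_trans ?_ hle
  rw [layer_enn hf fun x => ne_top_of_le_ne_top ENNReal.one_ne_top (fle x),
    layer_enn hg fun x => ne_top_of_le_ne_top ENNReal.one_ne_top (gle x),
    layer_enn (hh.min measurable_const)
      fun x => ne_top_of_le_ne_top ENNReal.one_ne_top (min_le_right _ _)]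
  have meas : ∀ u : ℝ → ℝ≥0∞, Measurable fun s : ℝ => volume {x | ENNReal.ofReal s < u x} := by
    intro u
    refine Antitone.measurable fun s t hst => measure_mono fun x hx => ?_
    exact lt_of_le_of_lt (ENNReal.ofReal_le_ofReal hst) hx
  rw [← lintegral_const_mul _ (meas f), ← lintegral_const_mul _ (meas g),
    ← lintegral_add_left ((meas f).const_mul _)]
  refine setLIntegral_mono (meas _) fun s hs => ?_
  have hs0 : (0:ℝ) < s := hs
  rcases lt_or_ge s 1 with hs1 | hs1
  · have hs1' : ENNReal.ofReal s < 1 := by simpa using hs1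
    have fne : {x | ENNReal.ofReal s < f x}.Nonempty := by
      rw [← hf1] at hs1'
      exact lt_iSup_iff.1 hs1'
    have gne : {x | ENNReal.ofReal s < g x}.Nonempty := by
      rw [← hg1] at hs1'
      exact lt_iSup_iff.1 hs1'
    refine bm_one (measurableSet_lt measurable_const hf) (measurableSet_lt measurable_const hg)
      fne gne hl hm ?_
    intro x hx y hy
    have hx' : ENNReal.ofReal s < f x := hx
    have hy' : ENNReal.ofReal s < g y := hy
    refine lt_min ?_ hs1'
    refine lt_of_lt_of_le ?_ (H x y)
    have e : ENNReal.ofReal s = ENNReal.ofReal s ^ l * ENNReal.ofReal s ^ m := by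
      rw [← ENNReal.rpow_add _ _ (by simpa using hs0) ENNReal.ofReal_ne_top, hlm,
        ENNReal.rpow_one]
    rw [e]
    exact ENNReal.mul_lt_mul (ENNReal.rpow_lt_rpow hx' hl) (ENNReal.rpow_lt_rpow hy' hm)
  · have hs1' : 1 ≤ ENNReal.ofReal s := by simpa using hs1
    have e1 : {x | ENNReal.ofReal s < f x} = ∅ :=
      eq_empty_of_forall_notMem fun x hx => absurd ((fle x).trans hs1') (not_le.2 hx)
    have e2 : {x | ENNReal.ofReal s < g x} = ∅ :=
      eq_empty_of_forall_notMem fun x hx => absurd ((gle x).trans hs1') (not_le.2 hx)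
    simp [e1, e2]

lemma amgm_enn (u v : ℝ≥0∞) {l m : ℝ} (hl : 0 < l) (hm : 0 < m) (hlm : l + m = 1) :
    u ^ l * v ^ m ≤ ENNReal.ofReal l * u + ENNReal.ofReal m * v := by
  by_cases hu : u = ⊤
  · have : ENNReal.ofReal l ≠ 0 := by simpa using hl
    simp [hu, ENNReal.mul_top this]
  by_cases hv : v = ⊤
  · have : ENNReal.ofReal m ≠ 0 := by simpa using hm
    simp [hv, ENNReal.mul_top this]
  have h := Real.geom_mean_le_arith_mean2_weighted hl.le hm.le (ENNReal.toReal_nonneg (a := u))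
    (ENNReal.toReal_nonneg (a := v)) hlm
  have h2 := ENNReal.ofReal_le_ofReal h
  rw [ENNReal.ofReal_mul (by positivity), ENNReal.ofReal_add (by positivity) (by positivity),
    ENNReal.ofReal_mul hl.le, ENNReal.ofReal_mul hm.le,
    ← ENNReal.ofReal_rpow_of_nonneg ENNReal.toReal_nonneg hl.le,
    ← ENNReal.ofReal_rpow_of_nonneg ENNReal.toReal_nonneg hm.le, ENNReal.ofReal_toReal hu,
    ENNReal.ofReal_toReal hv] at h2
  exact h2

lemma pl_bdd {f g h : ℝ → ℝ≥0∞} (hf : Measurable f) (hg : Measurable g) (hh : Measurable h)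
    (hf1 : ⨆ x, f x ≠ ⊤) (hg1 : ⨆ x, g x ≠ ⊤) {l m : ℝ} (hl : 0 < l) (hm : 0 < m)
    (hlm : l + m = 1)
    (H : ∀ x y, f x ^ l * g y ^ m ≤ h (l * x + m * y)) :
    (∫⁻ x, f x) ^ l * (∫⁻ x, g x) ^ m ≤ ∫⁻ x, h x := by
  set a := ⨆ x, f x with ha
  set b := ⨆ x, g x with hb
  by_cases ha0 : a = 0
  · have : ∀ x, f x = 0 := fun x => by
      have := le_iSup f x
      rw [← ha, ha0] at this
      exact le_antisymm this bot_le
    simp [this, hl]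
  by_cases hb0 : b = 0
  · have : ∀ x, g x = 0 := fun x => by
      have := le_iSup g x
      rw [← hb, hb0] at this
      exact le_antisymm this bot_le
    simp [this, hm]
  set c := a ^ l * b ^ m with hc
  have hal0 : a ^ l ≠ 0 := by simp [ENNReal.rpow_eq_zero_iff, ha0, hf1]
  have hbm0 : b ^ m ≠ 0 := by simp [ENNReal.rpow_eq_zero_iff, hb0, hg1]
  have halt : a ^ l ≠ ⊤ := ENNReal.rpow_ne_top_of_nonneg hl.le hf1
  have hbmt : b ^ m ≠ ⊤ := ENNReal.rpow_ne_top_of_nonneg hm.le hg1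
  have hc0 : c ≠ 0 := mul_ne_zero hal0 hbm0
  have hct : c ≠ ⊤ := ENNReal.mul_ne_top halt hbmt
  have cinv : c⁻¹ = (a⁻¹) ^ l * (b⁻¹) ^ m := by
    rw [hc, ENNReal.mul_inv (Or.inl hal0) (Or.inl halt), ENNReal.inv_rpow, ENNReal.inv_rpow]
  have key := pl_norm (f := fun x => a⁻¹ * f x) (g := fun x => b⁻¹ * g x) (h := fun x => c⁻¹ * h x)
    (hf.const_mul _) (hg.const_mul _) (hh.const_mul _)
    (by rw [← ENNReal.mul_iSup, ← ha]; exact ENNReal.inv_mul_cancel ha0 hf1)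
    (by rw [← ENNReal.mul_iSup, ← hb]; exact ENNReal.inv_mul_cancel hb0 hg1) hl hm hlm (by
      intro x y
      rw [ENNReal.mul_rpow_of_nonneg _ _ hl.le, ENNReal.mul_rpow_of_nonneg _ _ hm.le, cinv,
        mul_mul_mul_comm]
      gcongr
      exact H x y)
  have key2 := (amgm_enn _ _ hl hm hlm).trans key
  rw [lintegral_const_mul _ hf, lintegral_const_mul _ hg, lintegral_const_mul _ hh,
    ENNReal.mul_rpow_of_nonneg _ _ hl.le, ENNReal.mul_rpow_of_nonneg _ _ hm.le,
    mul_mul_mul_comm, ← cinv] at key2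
  exact (ENNReal.mul_le_mul_iff_right (ENNReal.inv_ne_zero.2 hct) (ENNReal.inv_ne_top.2 hc0)).1 key2

lemma pl_one {f g h : ℝ → ℝ≥0∞} (hf : Measurable f) (hg : Measurable g) (hh : Measurable h)
    {l m : ℝ} (hl : 0 < l) (hm : 0 < m) (hlm : l + m = 1)
    (H : ∀ x y, f x ^ l * g y ^ m ≤ h (l * x + m * y)) :
    (∫⁻ x, f x) ^ l * (∫⁻ x, g x) ^ m ≤ ∫⁻ x, h x := by
  have tr : ∀ u : ℝ → ℝ≥0∞, Measurable u →
      ∫⁻ x, u x = ⨆ N : ℕ, ∫⁻ x, min (u x) N := by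
    intro u hu
    rw [← lintegral_iSup (fun N => hu.min measurable_const)]
    · congr 1
      ext x
      refine le_antisymm ?_ (iSup_le fun N => min_le_left _ _)
      by_cases hx : u x = ⊤
      · simp [hx, ENNReal.iSup_natCast]
      · obtain ⟨N, hN⟩ := ENNReal.exists_nat_gt hx
        exact le_iSup_of_le N (le_min le_rfl hN.le)
    · intro i j hij x
      exact min_le_min le_rfl (by exact_mod_cast hij)
  have mono : ∀ u : ℝ → ℝ≥0∞, Monotone fun N : ℕ => ∫⁻ x, min (u x) N := by
    intro u i j hij
    exact lintegral_mono fun x => min_le_min le_rfl (by exact_mod_cast hij)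
  have fin : ∀ (u : ℝ → ℝ≥0∞) (N : ℕ), ⨆ x, min (u x) (N : ℝ≥0∞) ≠ ⊤ := fun u N =>
    ne_top_of_le_ne_top (ENNReal.natCast_ne_top N) (iSup_le fun x => min_le_right _ _)
  have key : ∀ N : ℕ, (∫⁻ x, min (f x) N) ^ l * (∫⁻ x, min (g x) N) ^ m ≤ ∫⁻ x, h x := by
    intro N
    refine pl_bdd (hf.min measurable_const) (hg.min measurable_const) hh (fin f N) (fin g N)
      hl hm hlm fun x y => le_trans ?_ (H x y)
    gcongr <;> exact min_le_left _ _
  have tf : Tendsto (fun N : ℕ => (∫⁻ x, min (f x) N) ^ l) atTop (nhds ((∫⁻ x, f x) ^ l)) := by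
    rw [tr f hf]
    exact ((ENNReal.continuous_rpow_const).tendsto _).comp (tendsto_atTop_iSup (mono f))
  have tg : Tendsto (fun N : ℕ => (∫⁻ x, min (g x) N) ^ m) atTop (nhds ((∫⁻ x, g x) ^ m)) := by
    rw [tr g hg]
    exact ((ENNReal.continuous_rpow_const).tendsto _).comp (tendsto_atTop_iSup (mono g))
  by_cases h1 : (∫⁻ x, f x) ^ l = 0
  · simp [h1]
  by_cases h2 : (∫⁻ x, g x) ^ m = 0
  · simp [h2]
  exact le_of_tendsto' (ENNReal.Tendsto.mul tf (Or.inl h1) tg (Or.inl h2)) key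

lemma pl_pi (n : ℕ) : ∀ {f g h : (Fin n → ℝ) → ℝ≥0∞} (_ : Measurable f) (_ : Measurable g)
    (_ : Measurable h) {l m : ℝ} (_ : 0 < l) (_ : 0 < m) (_ : l + m = 1)
    (_ : ∀ x y, f x ^ l * g y ^ m ≤ h (l • x + m • y)),
    (∫⁻ x, f x) ^ l * (∫⁻ x, g x) ^ m ≤ ∫⁻ x, h x := by
  induction n with
  | zero =>
    intro f g h hf hg hh l m hl hm hlm H
    have : ∀ u : (Fin 0 → ℝ) → ℝ≥0∞, ∫⁻ x, u x = u default := by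
      intro u
      rw [lintegral_unique]
      simp [volume_pi]
      congr 1
      exact Subsingleton.elim _ _
    rw [this, this, this]
    convert H default default
  | succ n ih =>
    intro f g h hf hg hh l m hl hm hlm H
    have mp := (volume_preserving_piFinSuccAbove (fun _ : Fin (n + 1) => ℝ) 0).symm
    have dec : ∀ u : (Fin (n + 1) → ℝ) → ℝ≥0∞, Measurable u →
        (∫⁻ x, u x = ∫⁻ t : ℝ, ∫⁻ y : Fin n → ℝ, u (Fin.cons t y)) ∧
        Measurable (fun p : ℝ × (Fin n → ℝ) => u (Fin.cons p.1 p.2)) := by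
      intro u hu
      have e : ∀ p : ℝ × (Fin n → ℝ),
          (MeasurableEquiv.piFinSuccAbove (fun _ : Fin (n + 1) => ℝ) 0).symm p
            = Fin.cons p.1 p.2 := by
        intro p
        simp [MeasurableEquiv.piFinSuccAbove, Fin.insertNthEquiv]
      have hm : Measurable (fun p : ℝ × (Fin n → ℝ) => u (Fin.cons p.1 p.2)) := by
        have h3 := hu.comp mp.measurable
        have h4 : (u ∘ (MeasurableEquiv.piFinSuccAbove (fun _ : Fin (n + 1) => ℝ) 0).symm)
            = fun p : ℝ × (Fin n → ℝ) => u (Fin.cons p.1 p.2) := by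
          funext p
          exact congrArg u (e p)
        rw [← h4]
        exact h3
      refine ⟨?_, hm⟩
      rw [← mp.lintegral_comp hu]
      simp only [e]
      exact lintegral_prod _ hm.aemeasurable
    obtain ⟨ef, mf⟩ := dec f hf
    obtain ⟨eg, mg⟩ := dec g hg
    obtain ⟨eh, mh⟩ := dec h hh
    rw [ef, eg, eh]
    refine pl_one mf.lintegral_prod_right' mg.lintegral_prod_right' mh.lintegral_prod_right'
      hl hm hlm fun s t => ?_
    refine ih (mf.comp measurable_prodMk_left) (mg.comp measurable_prodMk_left)
      (mh.comp measurable_prodMk_left) hl hm hlm fun x y => ?_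
    refine (H _ _).trans (le_of_eq ?_)
    simp only [Function.comp]
    congr 1
    ext i
    refine Fin.cases ?_ (fun j => ?_) i <;> simp

lemma pl_euc {n : ℕ} {f g h : EuclideanSpace ℝ (Fin n) → ℝ≥0∞} (hf : Measurable f)
    (hg : Measurable g) (hh : Measurable h) {l m : ℝ} (hl : 0 < l) (hm : 0 < m) (hlm : l + m = 1)
    (H : ∀ x y, f x ^ l * g y ^ m ≤ h (l • x + m • y)) :
    (∫⁻ x, f x) ^ l * (∫⁻ x, g x) ^ m ≤ ∫⁻ x, h x := by
  have mp := PiLp.volume_preserving_toLp (Fin n)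
  rw [← mp.lintegral_comp hf, ← mp.lintegral_comp hg, ← mp.lintegral_comp hh]
  refine pl_pi n (hf.comp mp.measurable) (hg.comp mp.measurable) (hh.comp mp.measurable)
    hl hm hlm fun x y => ?_
  exact H _ _

lemma int_exp_enn {r : ℝ} (hr : 0 < r) :
    ∫⁻ t in Ioi (0:ℝ), ENNReal.ofReal (Real.exp (-(r * t))) = ENNReal.ofReal (1 / r) := by
  have hi : ∫ t in Ioi (0:ℝ), Real.exp (-(r * t)) = 1 / r := by
    have := Real.integral_rpow_mul_exp_neg_mul_Ioi (a := 1) one_pos hr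
    simpa using this
  rw [← hi, ofReal_integral_eq_lintegral_ofReal]
  · by_contra h
    rw [integral_undef h] at hi
    have : (0:ℝ) < 1 / r := by positivity
    linarith
  · exact Eventually.of_forall fun t => (Real.exp_pos _).le

lemma int_mul_exp_enn {r : ℝ} (hr : 0 < r) :
    ∫⁻ t in Ioi (0:ℝ), ENNReal.ofReal (t * Real.exp (-(r * t))) = ENNReal.ofReal (1 / r ^ 2) := by
  have hi : ∫ t in Ioi (0:ℝ), t * Real.exp (-(r * t)) = 1 / r ^ 2 := by
    have := Real.integral_rpow_mul_exp_neg_mul_Ioi (a := 2) two_pos hr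
    norm_num at this
    simpa using this
  rw [← hi, ofReal_integral_eq_lintegral_ofReal]
  · by_contra h
    rw [integral_undef h] at hi
    have : (0:ℝ) < 1 / r ^ 2 := by positivity
    linarith
  · filter_upwards [ae_restrict_mem measurableSet_Ioi] with t ht
    exact mul_nonneg (le_of_lt ht) (Real.exp_pos _).le

lemma log_of_rpow {a b c l m : ℝ} (ha : 0 < a) (hb : 0 < b) 
    (h : a ^ l * b ^ m ≤ c) : l * Real.log a + m * Real.log b ≤ Real.log c := by
  have h1 := Real.log_le_log (by positivity) h
  rwa [Real.log_mul (by positivity) (by positivity), Real.log_rpow ha, Real.log_rpow hb] at h1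

lemma tail_compare {ν : ℝ → ℝ} (hanti : Antitone ν) (hnn : ∀ t, 0 ≤ ν t)
    (hlc : ∀ a b l m : ℝ, 0 < l → 0 < m → l + m = 1 → ν a ^ l * ν b ^ m ≤ ν (l * a + m * b))
    (h0 : 0 < ν 0) (h1 : ν 1 ≤ ν 0 * Real.exp (-1)) :
    ∫⁻ t in Ioi (0:ℝ), ENNReal.ofReal (ν t) * ENNReal.ofReal t
      ≤ ∫⁻ t in Ioi (0:ℝ), ENNReal.ofReal (ν t) := by
  have mν : Measurable fun t => ENNReal.ofReal (ν t) := hanti.measurable.ennreal_ofReal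
  rcases (hnn 1).eq_or_lt with hz | hp
  · refine setLIntegral_mono mν fun t ht => ?_
    rcases le_total t 1 with h | h
    · calc _ ≤ ENNReal.ofReal (ν t) * 1 := by
            gcongr
            simpa using h
        _ = _ := mul_one _
    · have : ν t = 0 := le_antisymm (by rw [hz]; exact hanti h) (hnn t)
      simp [this]
  obtain ⟨r, hr⟩ : ∃ r, r = Real.log (ν 0) - Real.log (ν 1) := ⟨_, rfl⟩
  have hr1 : 1 ≤ r := by
    have := Real.log_le_log hp h1
    rw [Real.log_mul h0.ne' (Real.exp_pos _).ne', Real.log_exp] at this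
    linarith
  have hr0 : 0 < r := by linarith
  have pt : ∀ t : ℝ, 0 < t → (t - 1) * (ν t - ν 0 * Real.exp (-(r * t))) ≤ 0 := by
    intro t ht
    have e0 : ν 0 * Real.exp (-(r * t)) = Real.exp (Real.log (ν 0) - r * t) := by
      rw [sub_eq_add_neg, Real.exp_add, Real.exp_log h0]
    rcases lt_trichotomy t 1 with h | h | h
    · refine mul_nonpos_of_nonpos_of_nonneg (by linarith) (sub_nonneg.2 ?_)
      have := hlc 1 0 t (1 - t) ht (by linarith) (by ring)
      simp only [mul_one, mul_zero, add_zero] at this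
      have hpt : 0 < ν t := lt_of_lt_of_le (by positivity) this
      have h2 := log_of_rpow hp h0 this
      rw [e0, ← Real.le_log_iff_exp_le hpt, hr]
      linarith
    · simp [h]
    · refine mul_nonpos_of_nonneg_of_nonpos (by linarith) (sub_nonpos.2 ?_)
      rcases (hnn t).eq_or_lt with hz | hpt
      · rw [← hz]; positivity
      have ht' : 1 / t < 1 := by rw [div_lt_one ht]; exact h
      have := hlc t 0 (1 / t) (1 - 1 / t) (by positivity) (by linarith) (by ring)
      have e1 : 1 / t * t + (1 - 1 / t) * 0 = 1 := by field_simp; simp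
      rw [e1] at this
      have h2 := log_of_rpow hpt h0 this
      rw [e0, ← Real.log_le_iff_le_exp hpt, hr]
      have h3 := mul_le_mul_of_nonneg_left h2 ht.le
      have e2 : t * (1 / t * Real.log (ν t) + (1 - 1 / t) * Real.log (ν 0))
        = Real.log (ν t) + (t - 1) * Real.log (ν 0) := by field_simp
      rw [e2] at h3
      linarith
  have hint : ∫⁻ t in Ioi (0:ℝ), (ENNReal.ofReal (ν t) * ENNReal.ofReal t
        + ENNReal.ofReal (ν 0) * ENNReal.ofReal (Real.exp (-(r * t))))
      ≤ ∫⁻ t in Ioi (0:ℝ), (ENNReal.ofReal (ν t)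
        + ENNReal.ofReal (ν 0) * ENNReal.ofReal (t * Real.exp (-(r * t)))) := by
    refine setLIntegral_mono (by fun_prop) fun t ht => ?_
    have ht0 : (0:ℝ) < t := ht
    have := pt t ht
    have hν := hnn t
    rw [← ENNReal.ofReal_mul hν, ← ENNReal.ofReal_mul h0.le, ← ENNReal.ofReal_mul h0.le,
      ← ENNReal.ofReal_add (by positivity) (by positivity),
      ← ENNReal.ofReal_add (by positivity) (by positivity)]
    refine ENNReal.ofReal_le_ofReal ?_
    linarith
  rw [lintegral_add_right _ (by fun_prop), lintegral_add_right _ (by fun_prop),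
    lintegral_const_mul _ (by fun_prop), lintegral_const_mul _ (by fun_prop),
    int_exp_enn hr0, int_mul_exp_enn hr0] at hint
  have hle : ENNReal.ofReal (1 / r ^ 2) ≤ ENNReal.ofReal (1 / r) := by
    refine ENNReal.ofReal_le_ofReal (one_div_le_one_div_of_le hr0 ?_)
    nlinarith
  have hfin : ENNReal.ofReal (ν 0) * ENNReal.ofReal (1 / r) ≠ ⊤ :=
    ENNReal.mul_ne_top ENNReal.ofReal_ne_top ENNReal.ofReal_ne_top
  refine (ENNReal.add_le_add_iff_right hfin).1 (hint.trans ?_)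
  gcongr

lemma tail_right {T : ℝ → ℝ} (hnn : ∀ t, 0 ≤ T t)
    (hlc : ∀ a b l m : ℝ, 0 < l → 0 < m → l + m = 1 → T a ^ l * T b ^ m ≤ T (l * a + m * b))
    (h2 : 3 / 4 ≤ T (-2)) (h3 : T (1 / 3) ≤ 1 / 1000) {u : ℝ} (hu : 0 < u) :
    T (1 / 3 + u) ≤ 1 / 1000 * Real.exp (-(2 * u)) := by
  rcases (hnn (1 / 3 + u)).eq_or_lt with hz | hp
  · rw [← hz]; positivity
  have hd : 0 < 7 / 3 + u := by linarith
  have := hlc (1 / 3 + u) (-2) ((7 / 3) / (7 / 3 + u)) (u / (7 / 3 + u)) (by positivity)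
    (by positivity) (by field_simp)
  have e : (7 / 3) / (7 / 3 + u) * (1 / 3 + u) + u / (7 / 3 + u) * (-2) = 1 / 3 := by
    field_simp; ring
  rw [e] at this
  have h4 := log_of_rpow hp (by linarith) (this.trans h3)
  have h5 := mul_le_mul_of_nonneg_left h4 hd.le
  have e2 : (7 / 3 + u) * ((7 / 3) / (7 / 3 + u) * Real.log (T (1 / 3 + u))
      + u / (7 / 3 + u) * Real.log (T (-2)))
      = 7 / 3 * Real.log (T (1 / 3 + u)) + u * Real.log (T (-2)) := by field_simp
  rw [e2] at h5
  have h6 : -(1 / 3) ≤ Real.log (T (-2)) := by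
    have a1 := Real.one_sub_inv_le_log_of_pos (x := T (-2)) (by linarith)
    have a2 : (T (-2))⁻¹ ≤ (3 / 4)⁻¹ := inv_anti₀ (by norm_num) h2
    norm_num at a2
    linarith
  have h7 : Real.log (1 / 1000) ≤ -6 := by
    rw [Real.log_le_iff_le_exp (by norm_num), Real.exp_neg, ← one_div]
    refine one_div_le_one_div_of_le (Real.exp_pos _) ?_
    have : Real.exp 6 = Real.exp 1 ^ 6 := by rw [← Real.exp_nat_mul]; norm_num
    rw [this]
    calc Real.exp 1 ^ 6 ≤ 3 ^ 6 := by
          gcongr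
          linarith [Real.exp_one_lt_d9]
      _ ≤ 1000 := by norm_num
  have e3 : 1 / 1000 * Real.exp (-(2 * u)) = Real.exp (Real.log (1 / 1000) - 2 * u) := by
    rw [sub_eq_add_neg, Real.exp_add, Real.exp_log (by norm_num)]
  rw [e3, ← Real.log_le_iff_le_exp hp]
  nlinarith [mul_le_mul_of_nonneg_left h6 hu.le, mul_le_mul_of_nonneg_left h7 hu.le]

lemma endgame {Ω : Type*} [MeasurableSpace Ω] (μ : Measure Ω) [IsProbabilityMeasure μ]
    (Y : Ω → ℝ) (hY : Measurable Y) (hi : Integrable Y μ) (hi2 : Integrable (fun x => Y x ^ 2) μ)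
    (hmean : ∫ x, Y x ∂μ = 0) (hvar : ∫ x, Y x ^ 2 ∂μ = 1)
    (hU : ∀ a b l m : ℝ, 0 < l → 0 < m → l + m = 1 →
      μ.real {x | a ≤ Y x} ^ l * μ.real {x | b ≤ Y x} ^ m ≤ μ.real {x | l * a + m * b ≤ Y x})
    (hL : ∀ a b l m : ℝ, 0 < l → 0 < m → l + m = 1 →
      μ.real {x | a ≤ - Y x} ^ l * μ.real {x | b ≤ - Y x} ^ m
        ≤ μ.real {x | l * a + m * b ≤ - Y x})
    (hδ : μ.real {x | 1 / 3 ≤ Y x} ≤ 1 / 1000) : False := by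
  have hT2 : 3 / 4 ≤ μ.real {x | -2 ≤ Y x} := by
    have c := mul_meas_ge_le_integral_of_nonneg (μ := μ) (f := fun x => Y x ^ 2)
      (Eventually.of_forall fun x => sq_nonneg _) hi2 4
    rw [hvar] at c
    have c2 : μ.real {x | -2 ≤ Y x}ᶜ ≤ μ.real {x | 4 ≤ Y x ^ 2} := by
      refine measureReal_mono fun x hx => ?_
      simp only [mem_compl_iff, mem_ofPred_eq, not_le] at hx ⊢
      nlinarith
    rw [probReal_compl_eq_one_sub (measurableSet_le measurable_const hY)] at c2
    linarith
  set W : Ω → ℝ := fun x => max (Y x - 1 / 3) 0 with hW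
  set Z : Ω → ℝ := fun x => max (1 / 3 - Y x) 0 with hZ
  have mW : Measurable W := by fun_prop
  have mZ : Measurable Z := by fun_prop
  have W0 : ∀ x, 0 ≤ W x := fun x => le_max_right _ _
  have Z0 : ∀ x, 0 ≤ Z x := fun x => le_max_right _ _
  have iW : Integrable W μ := (hi.sub (integrable_const _)).pos_part
  have iZ : Integrable Z μ := ((integrable_const _).sub hi).pos_part
  have sub1 : ∀ x, Z x - W x = 1 / 3 - Y x := by
    intro x
    rcases le_total (Y x) (1 / 3) with h | h
    · simp only [hZ, hW]
      rw [max_eq_left (by linarith), max_eq_right (by linarith)]; ring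
    · simp only [hZ, hW]
      rw [max_eq_right (by linarith), max_eq_left (by linarith)]; ring
  have sub2 : ∀ x, Z x ^ 2 + W x ^ 2 = (1 / 3 - Y x) ^ 2 := by
    intro x
    rcases le_total (Y x) (1 / 3) with h | h
    · simp only [hZ, hW]
      rw [max_eq_left (by linarith), max_eq_right (by linarith)]; ring
    · simp only [hZ, hW]
      rw [max_eq_right (by linarith), max_eq_left (by linarith)]; ring
  have iq : Integrable (fun x => (1 / 3 - Y x) ^ 2) μ := by
    have : (fun x => (1 / 3 - Y x) ^ 2) = fun x => 1 / 9 - 2 / 3 * Y x + Y x ^ 2 := by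
      ext x; ring
    rw [this]
    exact ((integrable_const _).sub (hi.const_mul _)).add hi2
  have iW2 : Integrable (fun x => W x ^ 2) μ := by
    refine iq.mono' (by fun_prop) (Eventually.of_forall fun x => ?_)
    rw [Real.norm_of_nonneg (sq_nonneg _), ← sub2]
    nlinarith [sq_nonneg (Z x)]
  have iZ2 : Integrable (fun x => Z x ^ 2) μ := by
    refine iq.mono' (by fun_prop) (Eventually.of_forall fun x => ?_)
    rw [Real.norm_of_nonneg (sq_nonneg _), ← sub2]
    nlinarith [sq_nonneg (W x)]
  have E1 : ∫ x, Z x ∂μ - ∫ x, W x ∂μ = 1 / 3 := by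
    rw [← integral_sub iZ iW]
    simp only [sub1]
    rw [integral_sub (integrable_const _) hi, hmean]
    simp
  have E2 : ∫ x, Z x ^ 2 ∂μ + ∫ x, W x ^ 2 ∂μ = 10 / 9 := by
    rw [← integral_add iZ2 iW2]
    simp only [sub2]
    have : (fun x => (1 / 3 - Y x) ^ 2) = fun x => 1 / 9 - 2 / 3 * Y x + Y x ^ 2 := by
      ext x; ring
    have i3 : Integrable (fun x => 1 / 9 - 2 / 3 * Y x) μ :=
      (integrable_const _).sub (hi.const_mul _)
    rw [this, integral_add i3 hi2,
      integral_sub (integrable_const _) (hi.const_mul _), integral_const_mul, hmean, hvar]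
    simp
    norm_num
  -- the right tail
  have EW : ∫ x, W x ^ 2 ∂μ + 2 * ∫ x, W x ∂μ ≤ 3 / 2000 := by
    have lc := lintegral_comp_eq_lintegral_meas_le_mul μ (f := W) (g := fun u => 2 * u + 2)
      (Eventually.of_forall W0) mW.aemeasurable
      (fun t ht => (by fun_prop : Continuous fun u : ℝ => 2 * u + 2).intervalIntegrable _ _)
      (by
        filter_upwards [ae_restrict_mem measurableSet_Ioi] with t ht
        have : (0:ℝ) < t := ht
        positivity)
    have e : ∀ x, ∫ t in (0:ℝ)..W x, (2 * t + 2) = W x ^ 2 + 2 * W x := by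
      intro x
      rw [intervalIntegral.integral_add
        ((by fun_prop : Continuous fun u : ℝ => 2 * u).intervalIntegrable _ _)
        (continuous_const.intervalIntegrable _ _),
        intervalIntegral.integral_const_mul, integral_id]
      simp; ring
    simp only [e] at lc
    have i4 : Integrable (fun x => W x ^ 2 + 2 * W x) μ := iW2.add (iW.const_mul 2)
    rw [← ofReal_integral_eq_lintegral_ofReal i4
      (Eventually.of_forall fun x => add_nonneg (sq_nonneg _) (mul_nonneg two_pos.le (W0 x)))] at lc
    rw [integral_add iW2 (iW.const_mul 2), integral_const_mul] at lc
    have b : ∫⁻ t in Ioi (0:ℝ), μ {a | t ≤ W a} * ENNReal.ofReal (2 * t + 2)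
        ≤ ∫⁻ t in Ioi (0:ℝ), (ENNReal.ofReal (1 / 500) * ENNReal.ofReal (t * Real.exp (-(2 * t)))
          + ENNReal.ofReal (1 / 500) * ENNReal.ofReal (Real.exp (-(2 * t)))) := by
      refine setLIntegral_mono (by fun_prop) fun t ht => ?_
      have ht0 : (0:ℝ) < t := ht
      have hs : {a | t ≤ W a} = {a | 1 / 3 + t ≤ Y a} := by
        ext a
        simp only [hW, mem_ofPred_eq, le_max_iff]
        constructor
        · rintro (h | h) <;> linarith
        · intro h; left; linarith
      have tr := tail_right (T := fun t => μ.real {x | t ≤ Y x}) (fun t => measureReal_nonneg)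
        hU hT2 hδ ht0
      rw [hs, ← ofReal_measureReal, ← ENNReal.ofReal_mul measureReal_nonneg,
        ← ENNReal.ofReal_mul (by norm_num), ← ENNReal.ofReal_mul (by norm_num),
        ← ENNReal.ofReal_add (by positivity) (by positivity)]
      refine ENNReal.ofReal_le_ofReal ?_
      have := mul_le_mul_of_nonneg_right tr (by positivity : 0 ≤ 2 * t + 2)
      refine this.trans (le_of_eq (by ring))
    rw [← lc, lintegral_add_right _ (by fun_prop), lintegral_const_mul _ (by fun_prop),
      lintegral_const_mul _ (by fun_prop), int_exp_enn two_pos, int_mul_exp_enn two_pos,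
      ← ENNReal.ofReal_mul (by norm_num), ← ENNReal.ofReal_mul (by norm_num),
      ← ENNReal.ofReal_add (by norm_num) (by norm_num),
      ENNReal.ofReal_le_ofReal_iff (by norm_num)] at b
    norm_num at b ⊢
    linarith
  have W2p : 0 ≤ ∫ x, W x ^ 2 ∂μ := integral_nonneg fun x => sq_nonneg _
  have Wp : 0 ≤ ∫ x, W x ∂μ := integral_nonneg W0
  -- the left tail
  have hs : ∀ t : ℝ, 0 < t → {a | t ≤ Z a} = {a | t - 1 / 3 ≤ - Y a} := by
    intro t ht0
    ext a
    simp only [hZ, mem_ofPred_eq, le_max_iff]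
    constructor
    · rintro (h | h) <;> linarith
    · intro h; left; linarith
  have g0 : 999 / 1000 ≤ μ.real {a | (0:ℝ) - 1 / 3 ≤ - Y a} := by
    have c2 : μ.real {x | 1 / 3 ≤ Y x}ᶜ ≤ μ.real {a | (0:ℝ) - 1 / 3 ≤ - Y a} := by
      refine measureReal_mono fun x hx => ?_
      simp only [mem_compl_iff, mem_ofPred_eq, not_le] at hx ⊢
      linarith
    rw [probReal_compl_eq_one_sub (measurableSet_le measurable_const hY)] at c2
    linarith
  have g1 : μ.real {a | (1:ℝ) - 1 / 3 ≤ - Y a} ≤ 1 / 3 + 3 / 4000 := by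
    have c := mul_meas_ge_le_integral_of_nonneg (μ := μ) (Eventually.of_forall Z0) iZ 1
    rw [hs 1 one_pos] at c
    linarith
  have cmp := tail_compare (ν := fun t => μ.real {a | t - 1 / 3 ≤ - Y a})
    (fun s t hst => measureReal_mono fun x hx => le_trans (sub_le_sub_right hst _) hx)
    (fun t => measureReal_nonneg)
    (fun a b l m hl hm hlm => by
      refine (hL (a - 1 / 3) (b - 1 / 3) l m hl hm hlm).trans (le_of_eq ?_)
      have : l * (a - 1 / 3) + m * (b - 1 / 3) = l * a + m * b - 1 / 3 := by
        linear_combination (-1 / 3) * hlm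
      simp only [this])
    (lt_of_lt_of_le (by norm_num) g0)
    (by
      have e1 : (9:ℝ) / 25 ≤ Real.exp (-1) := by
        rw [Real.exp_neg]
        have : (25 / 9 : ℝ)⁻¹ ≤ (Real.exp 1)⁻¹ :=
          inv_anti₀ (Real.exp_pos _) (by linarith [Real.exp_one_lt_d9])
        norm_num at this ⊢
        exact this
      refine g1.trans (le_trans ?_ (mul_le_mul g0 e1 (by norm_num) measureReal_nonneg))
      norm_num)
  have l1 := lintegral_comp_eq_lintegral_meas_le_mul μ (f := Z) (g := fun u => 1)
      (Eventually.of_forall Z0) mZ.aemeasurable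
      (fun t ht => (continuous_const).intervalIntegrable _ _)
      (Eventually.of_forall fun t => zero_le_one)
  have l2 := lintegral_comp_eq_lintegral_meas_le_mul μ (f := Z) (g := fun u => u)
      (Eventually.of_forall Z0) mZ.aemeasurable
      (fun t ht => (continuous_id).intervalIntegrable _ _)
      (by
        filter_upwards [ae_restrict_mem measurableSet_Ioi] with t ht
        exact le_of_lt ht)
  simp only [integral_id, intervalIntegral.integral_const, smul_eq_mul, mul_one, sub_zero,
    ENNReal.ofReal_one, ne_eq, OfNat.ofNat_ne_zero, not_false_eq_true, zero_pow] at l1 l2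
  rw [← ofReal_integral_eq_lintegral_ofReal iZ (Eventually.of_forall Z0)] at l1
  rw [← ofReal_integral_eq_lintegral_ofReal (iZ2.div_const 2)
    (Eventually.of_forall fun x => by positivity), integral_div] at l2
  have c1 : ∫⁻ t in Ioi (0:ℝ), μ {a | t ≤ Z a} =
      ∫⁻ t in Ioi (0:ℝ), ENNReal.ofReal (μ.real {a | t - 1 / 3 ≤ - Y a}) :=
    setLIntegral_congr_fun measurableSet_Ioi fun t ht => by
      simp only [hs t ht]
      rw [ofReal_measureReal]
  have c2 : ∫⁻ t in Ioi (0:ℝ), μ {a | t ≤ Z a} * ENNReal.ofReal t =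
      ∫⁻ t in Ioi (0:ℝ), ENNReal.ofReal (μ.real {a | t - 1 / 3 ≤ - Y a}) * ENNReal.ofReal t :=
    setLIntegral_congr_fun measurableSet_Ioi fun t ht => by
      simp only [hs t ht]
      rw [ofReal_measureReal]
  rw [← c1, ← c2, ← l1, ← l2, ENNReal.ofReal_le_ofReal_iff (integral_nonneg Z0)] at cmp
  linarith

def LC {n : ℕ} (g : Euc n → ℝ) : Prop :=
  ∀ (x y : Euc n) (l m : ℝ), 0 < l → 0 < m → l + m = 1 → g x ^ l * g y ^ m ≤ g (l • x + m • y)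

lemma convex_of_lc {n : ℕ} {g : Euc n → ℝ} (hlc : LC g) {c : ℝ} (hc : 0 < c) :
    Convex ℝ {x | c ≤ g x} := by
  rw [convex_iff_forall_pos]
  intro x hx y hy l m hl hm hlm
  have hx' : c ≤ g x := hx
  have hy' : c ≤ g y := hy
  refine le_trans ?_ (hlc x y l m hl hm hlm)
  calc c = c ^ l * c ^ m := by rw [← Real.rpow_add hc, hlm, Real.rpow_one]
    _ ≤ _ := by
      have h0 : 0 ≤ g x := hc.le.trans hx'
      gcongr

lemma exists_meas {n : ℕ} {f : Euc n → ℝ} (hf : IsLogConcaveFn f) :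
    ∃ g : Euc n → ℝ, Measurable g ∧ (∀ x, 0 ≤ g x) ∧ LC g ∧ (∀ x, g x ≤ f x) ∧
      f =ᵐ[volume] g := by
  obtain ⟨h0, h1⟩ := hf
  have hlc : LC f := by
    intro x y l m hl hm hlm
    have := h1 x y l hl.le (by linarith)
    rwa [← eq_sub_of_add_eq' hlm] at this
  set P : Set (Euc n) := {x | 0 < f x} with hP
  have cP : Convex ℝ P := by
    rw [convex_iff_forall_pos]
    intro x hx y hy l m hl hm hlm
    have hx' : 0 < f x := hx
    have hy' : 0 < f y := hy
    exact lt_of_lt_of_le (by positivity) (hlc x y l m hl hm hlm)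
  set S := interior P with hS
  have cS : Convex ℝ S := cP.interior
  have oS : IsOpen S := isOpen_interior
  have pS : ∀ x ∈ S, 0 < f x := fun x hx => interior_subset (s := P) hx
  have conc : ConcaveOn ℝ S (fun x => Real.log (f x)) := by
    refine concaveOn_iff_forall_pos.2 ⟨cS, ?_⟩
    intro x hx y hy l m hl hm hlm
    exact log_of_rpow (pS x hx) (pS y hy) (hlc x y l m hl hm hlm)
  have cont : ContinuousOn f S := by
    have := (conc.continuousOn oS).rexp
    refine this.congr fun x hx => ?_
    exact (Real.exp_log (pS x hx)).symm
  classical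
  refine ⟨S.indicator f, ?_, ?_, ?_, ?_, ?_⟩
  · have : S.indicator f = S.piecewise f (fun _ => 0) := by
      ext x; simp [Set.indicator, Set.piecewise]
    rw [this]
    exact cont.measurable_piecewise continuousOn_const oS.measurableSet
  · exact fun x => indicator_nonneg (fun x _ => h0 x) x
  · intro x y l m hl hm hlm
    by_cases hx : x ∈ S
    · by_cases hy : y ∈ S
      · rw [indicator_of_mem hx, indicator_of_mem hy,
          indicator_of_mem (cS hx hy hl.le hm.le hlm)]
        exact hlc x y l m hl hm hlm
      · rw [indicator_of_notMem hy, Real.zero_rpow hm.ne', mul_zero]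
        exact indicator_nonneg (fun x _ => h0 x) _
    · rw [indicator_of_notMem hx, Real.zero_rpow hl.ne', zero_mul]
      exact indicator_nonneg (fun x _ => h0 x) _
  · exact fun x => indicator_le_self' (fun x _ => h0 x) x
  · have fr : volume (frontier P) = 0 := cP.addHaar_frontier volume
    have : ∀ᵐ x ∂(volume : Measure (Euc n)), x ∉ frontier P := measure_eq_zero_iff_ae_notMem.1 fr
    filter_upwards [this] with x hx
    by_cases hxS : x ∈ S
    · rw [indicator_of_mem hxS]
    · rw [indicator_of_notMem hxS]
      have : x ∉ P := fun hxP => hx ⟨subset_closure hxP, hxS⟩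
      exact le_antisymm (not_lt.1 this) (h0 x)

lemma halfspace_lc {n : ℕ} {g : Euc n → ℝ} (mg : Measurable g) (g0 : ∀ x, 0 ≤ g x) (hlc : LC g)
    (μ : Measure (Euc n)) [IsProbabilityMeasure μ]
    (hμ : μ = volume.withDensity (fun x => ENNReal.ofReal (g x))) (θ : Euc n →L[ℝ] ℝ)
    (a b l m : ℝ) (hl : 0 < l) (hm : 0 < m) (hlm : l + m = 1) :
    μ.real {x | a ≤ θ x} ^ l * μ.real {x | b ≤ θ x} ^ m ≤ μ.real {x | l * a + m * b ≤ θ x} := by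
  have ms : ∀ s : ℝ, MeasurableSet {x | s ≤ θ x} := fun s =>
    measurableSet_le measurable_const θ.continuous.measurable
  have mG : Measurable fun x => ENNReal.ofReal (g x) := mg.ennreal_ofReal
  have e : ∀ s : ℝ, μ {x | s ≤ θ x}
      = ∫⁻ x, {x | s ≤ θ x}.indicator (fun x => ENNReal.ofReal (g x)) x := by
    intro s
    rw [hμ, withDensity_apply _ (ms s), lintegral_indicator (ms s)]
  have key := pl_euc (mG.indicator (ms a)) (mG.indicator (ms b))
    (mG.indicator (ms (l * a + m * b))) hl hm hlm (by
      intro x y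
      by_cases hx : a ≤ θ x
      · by_cases hy : b ≤ θ y
        · have hxy : l * a + m * b ≤ θ (l • x + m • y) := by
            simp only [map_add, map_smul, smul_eq_mul]
            gcongr
          rw [indicator_of_mem (by exact hx), indicator_of_mem (by exact hy),
            indicator_of_mem (by exact hxy), ENNReal.ofReal_rpow_of_nonneg (g0 x) hl.le,
            ENNReal.ofReal_rpow_of_nonneg (g0 y) hm.le,
            ← ENNReal.ofReal_mul (Real.rpow_nonneg (g0 x) _)]
          exact ENNReal.ofReal_le_ofReal (hlc x y l m hl hm hlm)
        · rw [indicator_of_notMem (a := y) (by exact hy), ENNReal.zero_rpow_of_pos hm, mul_zero]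
          exact bot_le
      · rw [indicator_of_notMem (a := x) (by exact hx), ENNReal.zero_rpow_of_pos hl, zero_mul]
        exact bot_le)
  rw [← e, ← e, ← e] at key
  have := ENNReal.toReal_mono (measure_ne_top μ _) key
  rwa [ENNReal.toReal_mul, ← ENNReal.toReal_rpow, ← ENNReal.toReal_rpow] at this

lemma small_level {n : ℕ} (hn : 3 ≤ n) {g : Euc n → ℝ} (mg : Measurable g) (g0 : ∀ x, 0 ≤ g x)
    (hlc : LC g) (μ : Measure (Euc n)) [IsProbabilityMeasure μ]
    (hμ : μ = volume.withDensity (fun x => ENNReal.ofReal (g x)))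
    {c : ℝ} (x₀ : Euc n) (hx₀ : Real.exp (5 * n) * c ≤ g x₀) :
    μ.real {x | g x < c} ≤ 1 / 1000 := by
  have tot : ∫⁻ x, ENNReal.ofReal (g x) = 1 := by
    have := measure_univ (μ := μ)
    rwa [hμ, withDensity_apply _ MeasurableSet.univ, Measure.restrict_univ] at this
  have ig : Integrable g := by
    refine ⟨mg.aestronglyMeasurable, ?_⟩
    rw [hasFiniteIntegral_iff_ofReal (Eventually.of_forall g0), tot]
    exact ENNReal.one_lt_top
  have ig1 : ∫ x, g x = 1 := by
    rw [integral_eq_lintegral_of_nonneg_ae (Eventually.of_forall g0) mg.aestronglyMeasurable, tot]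
    simp
  set A := {x | g x < c} with hA
  have mA : MeasurableSet A := measurableSet_lt mg measurable_const
  have eA : μ.real A = ∫ x, A.indicator g x := by
    rw [integral_indicator mA, integral_eq_lintegral_of_nonneg_ae (Eventually.of_forall g0)
      mg.aestronglyMeasurable, Measure.real, hμ, withDensity_apply _ mA]
  set F : Euc n → ℝ := fun y => g ((4 / 5 : ℝ) • x₀ + y) with hF
  have iF : Integrable F := ig.comp_add_left _
  have iF1 : ∫ y, F y = 1 := by
    rw [← ig1]
    exact integral_add_left_eq_self g _
  have iD : Integrable fun x => F ((1 / 5 : ℝ) • x) := iF.comp_smul (by norm_num)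
  have iD1 : ∫ x, F ((1 / 5 : ℝ) • x) = 5 ^ n := by
    rw [Measure.integral_comp_smul, iF1]
    simp
  have pt : ∀ x, Real.exp (4 * n) * A.indicator g x ≤ F ((1 / 5 : ℝ) • x) := by
    intro x
    have hFn : 0 ≤ F ((1 / 5 : ℝ) • x) := g0 _
    by_cases hx : x ∈ A
    · rw [indicator_of_mem hx]
      rcases (g0 x).eq_or_lt with hz | hp
      · rw [← hz]; simpa using hFn
      have hx' : g x < c := hx
      have h1 := hlc x₀ x (4 / 5) (1 / 5) (by norm_num) (by norm_num) (by norm_num)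
      refine le_trans ?_ h1
      have h2 : Real.exp (5 * n) * g x ≤ g x₀ :=
        le_trans (by gcongr) hx₀
      calc Real.exp (4 * n) * g x
          = (Real.exp (5 * n) * g x) ^ (4 / 5 : ℝ) * g x ^ (1 / 5 : ℝ) := by
            rw [Real.mul_rpow (Real.exp_pos _).le hp.le, ← Real.exp_mul, mul_assoc,
              ← Real.rpow_add hp]
            rw [show (5 * (n:ℝ)) * (4 / 5) = 4 * n by ring,
              show (4 / 5 : ℝ) + 1 / 5 = 1 by norm_num, Real.rpow_one]
        _ ≤ _ := by gcongr
    · rw [indicator_of_notMem hx]; simpa using hFn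
  have main := integral_mono ((ig.indicator mA).const_mul (Real.exp (4 * n))) iD pt
  rw [integral_const_mul, ← eA, iD1] at main
  have e4 : (50:ℝ) ≤ Real.exp 4 := by
    have : Real.exp 4 = Real.exp 1 ^ 4 := by rw [← Real.exp_nat_mul]; norm_num
    rw [this]
    calc (50:ℝ) ≤ 2.7 ^ 4 := by norm_num
      _ ≤ _ := by gcongr; linarith [Real.exp_one_gt_d9]
  have e4n : (50:ℝ) ^ n ≤ Real.exp (4 * n) := by
    have : Real.exp (4 * n) = Real.exp 4 ^ n := by rw [← Real.exp_nat_mul]; ring_nf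
    rw [this]
    gcongr
  have e50 : (50:ℝ) ^ n = 5 ^ n * 10 ^ n := by rw [← mul_pow]; norm_num
  have e10 : (1000:ℝ) ≤ 10 ^ n := by
    calc (1000:ℝ) = 10 ^ 3 := by norm_num
      _ ≤ _ := pow_le_pow_right₀ (by norm_num) hn
  have hr : 0 ≤ μ.real A := measureReal_nonneg
  have h5 : (0:ℝ) < 5 ^ n := by positivity
  have s1 : 5 ^ n * (1000 * μ.real A) ≤ 5 ^ n * 1 := by
    calc 5 ^ n * (1000 * μ.real A) ≤ 5 ^ n * (10 ^ n * μ.real A) := by gcongr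
      _ = 50 ^ n * μ.real A := by rw [e50]; ring
      _ ≤ Real.exp (4 * n) * μ.real A := by gcongr
      _ ≤ 5 ^ n * 1 := by simpa using main
  have := le_of_mul_le_mul_left s1 h5
  linarith

lemma main_meas {n : ℕ} (hn : 3 ≤ n) {g : Euc n → ℝ} (mg : Measurable g) (g0 : ∀ x, 0 ≤ g x)
    (hlc : LC g) (μ : Measure (Euc n)) [IsProbabilityMeasure μ]
    (hμ : μ = volume.withDensity (fun x => ENNReal.ofReal (g x)))
    (hcent : ∫ x, x ∂μ = 0)
    (hiso : ∀ i j : Fin n, ∫ x, x i * x j ∂μ = if i = j then 1 else 0)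
    (x : Euc n) (hx : ‖x‖ ≤ 1 / 3) : Real.exp (-(6 * n)) * essSup g volume ≤ g x := by
  set M := essSup g volume with hM
  rcases le_or_gt M 0 with hM0 | hM0
  · exact (mul_nonpos_of_nonneg_of_nonpos (Real.exp_pos _).le hM0).trans (g0 x)
  set c := Real.exp (-(6 * n)) * M with hc
  have hc0 : 0 < c := by positivity
  by_contra! hxc
  obtain ⟨x₀, hx₀⟩ : ∃ x₀, Real.exp (5 * n) * c ≤ g x₀ := by
    by_contra! hall
    have h1 : M ≤ Real.exp (5 * n) * c := by
      refine limsup_le_of_le ?_ (Eventually.of_forall fun x => (hall x).le)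
      exact isCoboundedUnder_le_of_le _ (x := 0) g0
    rw [hc, ← mul_assoc, ← Real.exp_add] at h1
    have h2 : Real.exp (5 * n + -(6 * n)) < 1 := by
      rw [Real.exp_lt_one_iff]
      have : (3:ℝ) ≤ n := by exact_mod_cast hn
      linarith
    nlinarith
  have sm := small_level hn mg g0 hlc μ hμ x₀ hx₀
  set C := {x | c ≤ g x} with hC
  have cC : Convex ℝ C := convex_of_lc hlc hc0
  have fr : μ (frontier C) = 0 := by
    have : μ ≪ volume := by rw [hμ]; exact withDensity_absolutelyContinuous _ _
    exact this (cC.addHaar_frontier volume)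
  have out : ∀ S : Set (Euc n), (∀ y ∈ S, y ∉ interior C) → μ.real S ≤ 1 / 1000 := by
    intro S hS
    have h1 : S ⊆ {x | g x < c} ∪ frontier C := by
      intro y hy
      by_cases hyC : y ∈ C
      · exact Or.inr ⟨subset_closure hyC, hS y hy⟩
      · exact Or.inl (show g y < c from not_le.1 (fun h => hyC h))
    calc μ.real S ≤ μ.real ({x | g x < c} ∪ frontier C) := measureReal_mono h1
      _ ≤ μ.real {x | g x < c} + μ.real (frontier C) := measureReal_union_le _ _
      _ ≤ 1 / 1000 := by
        have : μ.real (frontier C) = 0 := by simp [Measure.real, fr]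
        rw [this]; linarith
  have ne : (interior C).Nonempty := by
    by_contra h
    rw [not_nonempty_iff_eq_empty] at h
    have := out univ (by simp [h])
    rw [probReal_univ] at this
    norm_num at this
  obtain ⟨z, hz⟩ := ne
  obtain ⟨φ, hφ⟩ := geometric_hahn_banach_open_point cC.interior isOpen_interior
    (fun h => absurd (interior_subset (s := C) h) (not_le.2 hxc))
  have hφ0 : φ ≠ 0 := by
    rintro rfl
    have := hφ z hz
    simp at this
  have hφn : 0 < ‖φ‖ := norm_pos_iff.2 hφ0
  obtain ⟨w, hw⟩ : ∃ w : Euc n, w = (InnerProductSpace.toDual ℝ (Euc n)).symm φ := ⟨_, rfl⟩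
  have hwφ : ∀ y, φ y = inner ℝ w y := by
    intro y
    rw [hw, InnerProductSpace.toDual_symm_apply]
  have hwn : ‖w‖ = ‖φ‖ := by rw [hw, LinearIsometryEquiv.norm_map]
  set v : Euc n := (‖φ‖)⁻¹ • w with hv
  have vn : ‖v‖ = 1 := by
    rw [hv, norm_smul, hwn, norm_inv, norm_norm, inv_mul_cancel₀ hφn.ne']
  set θ : Euc n →L[ℝ] ℝ := innerSL ℝ v with hθ
  have hθa : ∀ y, θ y = inner ℝ v y := fun y => rfl
  have hθφ : ∀ y, θ y = ‖φ‖⁻¹ * φ y := by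
    intro y
    rw [hθa, hv, real_inner_smul_left, hwφ]
  have hδ : μ.real {y | 1 / 3 ≤ θ y} ≤ 1 / 1000 := by
    refine out _ fun y hy hyC => ?_
    have h1 : 1 / 3 ≤ θ y := hy
    have h2 := hφ y hyC
    have h3 : θ y < θ x := by
      rw [hθφ, hθφ]
      gcongr
    have h4 : θ x ≤ ‖x‖ := by
      rw [hθa]
      refine (real_inner_le_norm v x).trans ?_
      rw [vn, one_mul]
    linarith
  -- moments
  have isq : ∀ i : Fin n, Integrable (fun x : Euc n => x i * x i) μ := by
    intro i
    by_contra h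
    have := hiso i i
    rw [integral_undef h] at this
    simp at this
  have inorm : Integrable (fun x : Euc n => ‖x‖ ^ 2) μ := by
    have : (fun x : Euc n => ‖x‖ ^ 2) = fun x => ∑ i, x i * x i := by
      ext x
      rw [EuclideanSpace.real_norm_sq_eq]
      simp [sq]
    rw [this]
    exact integrable_finsetSum _ fun i _ => isq i
  have iid : Integrable (fun x : Euc n => x) μ := by
    refine ((integrable_const 1).add inorm).mono' (by fun_prop) (Eventually.of_forall fun x => ?_)
    simp only [Pi.add_apply]
    nlinarith [sq_nonneg (‖x‖ - 1), norm_nonneg x]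
  have icross : ∀ i j : Fin n, Integrable (fun x : Euc n => x i * x j) μ := by
    intro i j
    refine inorm.mono' (by fun_prop) (Eventually.of_forall fun x => ?_)
    rw [norm_mul, sq]
    have h1 := PiLp.norm_apply_le x i
    have h2 := PiLp.norm_apply_le x j
    gcongr
  have sqe : ∀ y, θ y ^ 2 = ∑ i, ∑ j, (v i * v j) * (y i * y j) := by
    intro y
    have : θ y = ∑ i, v i * y i := by
      rw [hθa, PiLp.inner_apply]
      simp [mul_comm]
    rw [this, sq, Finset.sum_mul_sum]
    refine Finset.sum_congr rfl fun i _ => Finset.sum_congr rfl fun j _ => by ring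
  have iY2 : Integrable (fun y => θ y ^ 2) μ := by
    simp only [sqe]
    exact integrable_finsetSum _ fun i _ => integrable_finsetSum _ fun j _ =>
      (icross i j).const_mul _
  refine endgame μ (fun y => θ y) θ.continuous.measurable (θ.integrable_comp iid) iY2 ?_ ?_
    (halfspace_lc mg g0 hlc μ hμ θ) (halfspace_lc mg g0 hlc μ hμ (-θ)) hδ
  · rw [ContinuousLinearMap.integral_comp_comm θ iid, hcent, map_zero]
  · simp only [sqe]
    rw [integral_finsetSum _ fun i _ => integrable_finsetSum _ fun j _ =>
      (icross i j).const_mul _]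
    have : ∀ i : Fin n, ∫ y, ∑ j, (v i * v j) * (y i * y j) ∂μ = v i * v i := by
      intro i
      rw [integral_finsetSum _ fun j _ => (icross i j).const_mul _]
      simp only [integral_const_mul, hiso]
      simp
    simp only [this]
    have h2 : ‖v‖ ^ 2 = 1 := by rw [vn]; norm_num
    rw [EuclideanSpace.real_norm_sq_eq] at h2
    rw [← h2]
    exact Finset.sum_congr rfl fun i _ => by ring

theorem inradius_superLevelSet_ge {n : ℕ} (hn : 3 ≤ n)
    (f : Euc n → ℝ) (μ : Measure (Euc n))
    [IsProbabilityMeasure μ]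
    (hf : IsLogConcaveFn f)
    (hμ : μ = volume.withDensity (fun x => ENNReal.ofReal (f x)))
    (hcent : ∫ x, x ∂μ = 0)
    (hiso : ∀ i j : Fin n, ∫ x, x i * x j ∂μ = if i = j then 1 else 0) :
    closedBall (0 : Euc n) (1 / 3) ⊆ superLevelSet f (6 * n) := by
  obtain ⟨g, mg, g0, hlc, gle, hae⟩ := exists_meas hf
  have hμ' : μ = volume.withDensity (fun x => ENNReal.ofReal (g x)) := by
    rw [hμ]
    refine withDensity_congr_ae ?_
    filter_upwards [hae] with x hx
    rw [hx]
  intro x hx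
  have h := main_meas hn mg g0 hlc μ hμ' hcent hiso x (by simpa using hx)
  rw [← essSup_congr_ae hae] at h
  exact h.trans (gle x)
end
end

section
/- Let μ be a centered log-concave probability measure on ℝ^n, and let A ⊂ ℝ^n be a convex body such that rB₂ⁿ ⊆ A for some r > 0. Then μ⁺(∂A) ≤ 2n μ(A)/r. -/
open MeasureTheory Metric Filter Set Pointwise

noncomputable section

/-- The `μ`-perimeter `μ⁺(∂A) = liminf_{ε→0⁺} μ((A + εB₂ⁿ) \ A) / ε`. -/
def muPerim {n : ℕ} (μ : Measure (Euc n)) (A : Set (Euc n)) : ℝ :=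
  liminf (fun ε : ℝ => (μ ((A + closedBall (0 : Euc n) ε) \ A)).toReal / ε)
    (nhdsWithin 0 (Ioi 0))

/-- A convex body: compact convex set with nonempty interior. -/
def IsConvexBody {n : ℕ} (A : Set (Euc n)) : Prop :=
  Convex ℝ A ∧ IsCompact A ∧ (interior A).Nonempty

lemma lc_convex {n : ℕ} {f : Euc n → ℝ} (hf : IsLogConcaveFn f) (a : ℝ) :
    Convex ℝ {x | a < f x} := by
  intro x hx y hy s t hs ht hst
  simp only [mem_ofPred_eq] at *
  obtain rfl : t = 1 - s := by linarith
  refine lt_of_lt_of_le ?_ (hf.2 x y s hs (by linarith))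
  rcases lt_or_ge a 0 with ha | ha
  · exact ha.trans_le (mul_nonneg (Real.rpow_nonneg (hf.1 x) _) (Real.rpow_nonneg (hf.1 y) _))
  · set m := min (f x) (f y) with hm
    have hma : a < m := lt_min hx hy
    have hm0 : 0 < m := ha.trans_lt hma
    calc a < m := hma
      _ = m ^ s * m ^ (1 - s) := by
        rw [← Real.rpow_add hm0]; simp
      _ ≤ f x ^ s * f y ^ (1 - s) := by
        gcongr
        · exact Real.rpow_nonneg (hf.1 x) _
        · exact min_le_left _ _
        · exact min_le_right _ _

lemma lc_aemeasurable {n : ℕ} {f : Euc n → ℝ} (hf : IsLogConcaveFn f) :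
    AEMeasurable f volume := by
  apply NullMeasurable.aemeasurable
  refine @measurable_of_Ioi ℝ (NullMeasurableSpace (Euc n) volume) _ _ _ _ _ _ _ _ ?_
  intro a
  exact (lc_convex hf a).nullMeasurableSet volume

lemma scale_lintegral {n : ℕ} (F : Euc n → ENNReal) {t : ℝ} (ht : 0 < t) (v : Euc n) :
    ∫⁻ x, F (t • x + v) = ENNReal.ofReal ((t ^ n)⁻¹) * ∫⁻ x, F x := by
  have h1 := lintegral_map_equiv (μ := (volume : Measure (Euc n))) (fun z => F (z + v))
    (Homeomorph.smulOfNeZero t ht.ne').toMeasurableEquiv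
  have h2 : (Measure.map (⇑(Homeomorph.smulOfNeZero (α := Euc n) t ht.ne').toMeasurableEquiv)
      (volume : Measure (Euc n))) = ENNReal.ofReal ((t ^ n)⁻¹) • volume := by
    have := Measure.map_addHaar_smul (volume : Measure (Euc n)) ht.ne'
    rw [finrank_euclideanSpace_fin, abs_of_pos (by positivity)] at this
    exact this
  rw [h2, lintegral_smul_measure, lintegral_add_right_eq_self] at h1
  exact h1.symm

lemma lc_pow_int {n : ℕ} {f : Euc n → ℝ} (hf : IsLogConcaveFn f)
    (h1 : ∫⁻ x, ENNReal.ofReal (f x) = 1) {t : ℝ} (ht : 0 < t) (ht1 : t < 1) (y : Euc n) :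
    ∫⁻ x, ENNReal.ofReal (f x ^ t * f y ^ (1 - t)) ≤ ENNReal.ofReal ((t ^ n)⁻¹) := by
  have := scale_lintegral (fun x => ENNReal.ofReal (f x)) ht ((1 - t) • y)
  rw [h1, mul_one] at this
  rw [← this]
  exact lintegral_mono fun x => ENNReal.ofReal_le_ofReal (hf.2 x y t ht.le ht1.le)

/-- interior of a superlevel set -/
lemma lc_ball {n : ℕ} {f : Euc n → ℝ} (hf : IsLogConcaveFn f)
    (h1 : ∫⁻ x, ENNReal.ofReal (f x) = 1) :
    ∃ c > 0, ∃ y : Euc n, ∃ ρ > 0, ∀ z ∈ ball y ρ, c < f z := by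
  have h : ∃ k : ℕ, volume {x | 1 / ((k : ℝ) + 1) < f x} ≠ 0 := by
    by_contra! hcon
    have h0 : volume (⋃ k : ℕ, {x | 1 / ((k : ℝ) + 1) < f x}) = 0 := measure_iUnion_null hcon
    have : ∀ᵐ x : Euc n, ENNReal.ofReal (f x) = 0 := by
      filter_upwards [measure_eq_zero_iff_ae_notMem.1 h0] with x hx
      simp only [mem_iUnion, mem_ofPred_eq, not_exists, not_lt] at hx
      rw [ENNReal.ofReal_eq_zero]
      by_contra! hx0
      obtain ⟨k, hk⟩ := exists_nat_one_div_lt hx0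
      exact absurd (hx k) (not_le.2 hk)
    rw [lintegral_congr_ae this] at h1
    simp at h1
  obtain ⟨k, hk⟩ := h
  have hint : (interior {x | 1 / ((k : ℝ) + 1) < f x}).Nonempty := by
    by_contra hemp
    rw [not_nonempty_iff_eq_empty] at hemp
    apply hk
    have h2 := (lc_convex hf (1 / ((k : ℝ) + 1))).addHaar_frontier volume
    refine measure_mono_null ?_ h2
    rw [frontier, hemp, sdiff_empty]
    exact subset_closure
  obtain ⟨y, hy⟩ := hint
  obtain ⟨ρ, hρ, hb⟩ := Metric.isOpen_iff.1 isOpen_interior y hy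
  exact ⟨1 / ((k : ℝ) + 1), by positivity, y, ρ, hρ, fun z hz => by
    have := interior_subset (hb hz)
    exact this⟩

lemma lc_bdd {n : ℕ} {f : Euc n → ℝ} (hf : IsLogConcaveFn f)
    (h1 : ∫⁻ x, ENNReal.ofReal (f x) = 1) {a : ℝ} (ha : 0 < a) :
    ∃ R > 0, ∀ x, a ≤ f x → ‖x‖ ≤ R := by
  obtain ⟨c, hc, y, ρ, hρ, hb⟩ := lc_ball hf h1
  set μ : Measure (Euc n) := volume.withDensity (fun x => ENNReal.ofReal (f x)) with hμ
  have : IsFiniteMeasure μ := ⟨by rw [hμ, withDensity_apply _ MeasurableSet.univ]; simp [h1]⟩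
  set d := a ^ (1/2 : ℝ) * c ^ (1 - 1/2 : ℝ) with hd
  have hd0 : 0 < d := by positivity
  set η : ENNReal := ENNReal.ofReal d * volume (ball (0 : Euc n) (ρ / 2)) with hη
  have hη0 : 0 < η := by
    refine ENNReal.mul_pos (by simpa using hd0) (measure_ball_pos _ _ (by positivity)).ne'
  have hηt : η ≠ ⊤ := ENNReal.mul_ne_top (by simp) measure_ball_lt_top.ne
  obtain ⟨K, hK, hKμ⟩ := isTightMeasureSet_iff_exists_isCompact_measure_compl_le.1
    (isTightMeasureSet_singleton (μ := μ)) (η / 2) (ENNReal.half_pos hη0.ne')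
  have hKμ := hKμ μ rfl
  obtain ⟨R, hR⟩ := hK.isBounded.exists_norm_le
  refine ⟨2 * |R| + ρ + ‖y‖ + 1, by positivity, fun x hx => ?_⟩
  by_contra! hlt
  have hdisj : ball ((1/2 : ℝ) • (x + y)) (ρ / 2) ⊆ Kᶜ := by
    intro z hz hzK
    have hz1 := hR z hzK
    rw [mem_ball, dist_eq_norm] at hz
    have : x = (2 : ℝ) • z - (2 : ℝ) • (z - (1/2 : ℝ) • (x + y)) - y := by
      module
    have h3 : ‖x‖ ≤ 2 * ‖z‖ + 2 * ‖z - (1/2 : ℝ) • (x + y)‖ + ‖y‖ := by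
      calc ‖x‖ = ‖(2 : ℝ) • z - (2 : ℝ) • (z - (1/2 : ℝ) • (x + y)) - y‖ := by rw [← this]
        _ ≤ ‖(2 : ℝ) • z‖ + ‖(2 : ℝ) • (z - (1/2 : ℝ) • (x + y))‖ + ‖y‖ :=
          (norm_sub_le _ _).trans (by gcongr; exact norm_sub_le _ _)
        _ = _ := by rw [norm_smul, norm_smul]; simp
    have := le_abs_self R
    linarith
  have hle : η ≤ μ (ball ((1/2 : ℝ) • (x + y)) (ρ / 2)) := by
    rw [hμ, withDensity_apply _ measurableSet_ball, hη,
      ← Measure.addHaar_ball_center volume ((1/2 : ℝ) • (x + y)) (ρ / 2), ← setLIntegral_const]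
    refine setLIntegral_mono' measurableSet_ball fun z hz => ENNReal.ofReal_le_ofReal ?_
    have hz' : (2 : ℝ) • z - x ∈ ball y ρ := by
      rw [mem_ball, dist_eq_norm] at hz ⊢
      have : (2 : ℝ) • z - x - y = (2 : ℝ) • (z - (1/2 : ℝ) • (x + y)) := by module
      rw [this, norm_smul, Real.norm_ofNat]; linarith
    have h4 := hf.2 x ((2 : ℝ) • z - x) (1/2) (by norm_num) (by norm_num)
    have h5 : (1/2 : ℝ) • x + (1 - 1/2 : ℝ) • ((2 : ℝ) • z - x) = z := by module
    rw [h5] at h4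
    refine le_trans ?_ h4
    have := hb _ hz'
    rw [hd]
    gcongr
    exact Real.rpow_nonneg (hf.1 x) _
  have := (hle.trans (measure_mono hdisj)).trans hKμ
  exact absurd this (not_le.2 (ENNReal.half_lt_self hη0.ne' hηt))

lemma lc_decay {n : ℕ} {f : Euc n → ℝ} (hf : IsLogConcaveFn f)
    (h1 : ∫⁻ x, ENNReal.ofReal (f x) = 1) {y : Euc n} (hy : 0 < f y) :
    ∃ D > 0, ∀ x, ‖x‖ * f x ≤ D * f x + 2 * D * (f x ^ (1/2 : ℝ) * f y ^ (1 - 1/2 : ℝ)) := by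
  obtain ⟨R, hR, hb⟩ := lc_bdd hf h1 (a := f y * Real.exp (-1)) (by positivity)
  set D := R + ‖y‖ + 1 with hD
  have hD0 : 0 < D := by positivity
  refine ⟨‖y‖ + D, by positivity, fun x => ?_⟩
  have hfx := hf.1 x
  have htri : ‖x‖ ≤ ‖y‖ + ‖x - y‖ := by
    calc ‖x‖ = ‖y + (x - y)‖ := by simp
      _ ≤ _ := norm_add_le _ _
  have hnn : 0 ≤ f x ^ (1/2 : ℝ) * f y ^ (1 - 1/2 : ℝ) := by positivity
  rcases hfx.eq_or_lt with h0 | h0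
  · rw [← h0] at hnn ⊢
    simp
  rcases le_or_gt ‖x - y‖ D with hs | hs
  · have : ‖x‖ * f x ≤ (‖y‖ + D) * f x := by gcongr; linarith
    have : 0 ≤ 2 * (‖y‖ + D) * (f x ^ (1/2 : ℝ) * f y ^ (1 - 1/2 : ℝ)) := by positivity
    linarith
  · have hs0 : 0 < ‖x - y‖ := hD0.trans hs
    set τ := D / ‖x - y‖ with hτ
    have hτ0 : 0 < τ := by positivity
    have hτ1 : τ ≤ 1 := by rw [hτ, div_le_one hs0]; exact hs.le
    have hp := hf.2 x y τ hτ0.le hτ1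
    have hplt : f (τ • x + (1 - τ) • y) < f y * Real.exp (-1) := by
      by_contra! hcon
      have h2 := hb _ hcon
      have h3 : τ • (x - y) = (τ • x + (1 - τ) • y) - y := by module
      have h4 : ‖τ • (x - y)‖ = D := by
        rw [norm_smul, Real.norm_of_nonneg hτ0.le, hτ]; field_simp
      rw [h3] at h4
      have h5 := norm_sub_le (τ • x + (1 - τ) • y) y
      linarith
    have h6 := Real.log_lt_log (by positivity) (hp.trans_lt hplt)
    rw [Real.log_mul (by positivity) (by positivity), Real.log_rpow h0, Real.log_rpow hy,
      Real.log_mul hy.ne' (Real.exp_pos _).ne', Real.log_exp] at h6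
    have h7 : 1 < τ * (Real.log (f y) - Real.log (f x)) := by linarith
    have h8 : ‖x - y‖ ≤ D * (Real.log (f y) - Real.log (f x)) := by
      have : ‖x - y‖ * 1 ≤ ‖x - y‖ * (τ * (Real.log (f y) - Real.log (f x))) := by gcongr
      rw [mul_one, ← mul_assoc, hτ, mul_div_cancel₀ _ hs0.ne'] at this
      exact this
    have h9 : f x * (Real.log (f y) - Real.log (f x)) ≤
        2 * (f x ^ (1/2 : ℝ) * f y ^ (1 - 1/2 : ℝ)) := by
      have e1 : Real.log (f y) - Real.log (f x) = 2 * Real.log ((f y / f x) ^ (1/2 : ℝ)) := by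
        rw [Real.log_rpow (by positivity), Real.log_div hy.ne' h0.ne']; ring
      have e2 : Real.log ((f y / f x) ^ (1/2 : ℝ)) ≤ (f y / f x) ^ (1/2 : ℝ) :=
        (Real.log_le_sub_one_of_pos (by positivity)).trans (by linarith)
      have e3 : f x * (f y / f x) ^ (1/2 : ℝ) = f x ^ (1/2 : ℝ) * f y ^ (1 - 1/2 : ℝ) := by
        have : (1 - 1/2 : ℝ) = 1/2 := by norm_num
        rw [this, Real.div_rpow hy.le h0.le]
        have h10 : f x = f x ^ (1/2 : ℝ) * f x ^ (1/2 : ℝ) := by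
          rw [← Real.rpow_add h0]; norm_num
        have h11 : f x ^ (1/2 : ℝ) ≠ 0 := by positivity
        nth_rewrite 1 [h10]
        field_simp
      rw [e1, ← e3]
      nlinarith
    have h12 : ‖x - y‖ * f x ≤ 2 * D * (f x ^ (1/2 : ℝ) * f y ^ (1 - 1/2 : ℝ)) := by
      calc ‖x - y‖ * f x ≤ D * (Real.log (f y) - Real.log (f x)) * f x := by gcongr
        _ = D * (f x * (Real.log (f y) - Real.log (f x))) := by ring
        _ ≤ D * (2 * (f x ^ (1/2 : ℝ) * f y ^ (1 - 1/2 : ℝ))) := by gcongr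
        _ = _ := by ring
    have h13 : ‖x‖ * f x ≤ (‖y‖ + ‖x - y‖) * f x := by gcongr
    have h14 := mul_nonneg (norm_nonneg y) hnn
    nlinarith [mul_nonneg hD0.le hfx]

lemma lc_integrable {n : ℕ} {f : Euc n → ℝ} (hf : IsLogConcaveFn f)
    (h1 : ∫⁻ x, ENNReal.ofReal (f x) = 1) :
    Integrable (fun x : Euc n => x) (volume.withDensity (fun x => ENNReal.ofReal (f x))) := by
  obtain ⟨c, hc, y, ρ, hρ, hb⟩ := lc_ball hf h1
  have hy : 0 < f y := hc.trans (hb y (mem_ball_self hρ))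
  obtain ⟨D, hD, hdec⟩ := lc_decay hf h1 hy
  refine ⟨aestronglyMeasurable_id, ?_⟩
  rw [hasFiniteIntegral_iff_norm]
  have hm := lc_aemeasurable hf
  rw [lintegral_withDensity_eq_lintegral_mul₀ hm.ennreal_ofReal (by fun_prop)]
  have hle : ∫⁻ x, ((fun x : Euc n => ENNReal.ofReal (f x)) * (fun x : Euc n => ENNReal.ofReal ‖x‖)) x ≤
      ∫⁻ x, (ENNReal.ofReal D * ENNReal.ofReal (f x) + ENNReal.ofReal (2 * D) *
        ENNReal.ofReal (f x ^ (1/2 : ℝ) * f y ^ (1 - 1/2 : ℝ))) := by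
    refine lintegral_mono fun x => ?_
    have hfx := hf.1 x
    rw [Pi.mul_apply, ← ENNReal.ofReal_mul hfx, ← ENNReal.ofReal_mul hD.le,
      ← ENNReal.ofReal_mul (by positivity), ← ENNReal.ofReal_add (by positivity) (by positivity),
      mul_comm]
    exact ENNReal.ofReal_le_ofReal (hdec x)
  refine hle.trans_lt ?_
  rw [lintegral_add_left' (hm.ennreal_ofReal.const_mul _), lintegral_const_mul' _ _ ENNReal.ofReal_ne_top,
    lintegral_const_mul' _ _ ENNReal.ofReal_ne_top, h1]
  refine ENNReal.add_lt_top.2 ⟨by simp, ENNReal.mul_lt_top ENNReal.ofReal_lt_top ?_⟩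
  exact (lc_pow_int hf h1 (by norm_num) (by norm_num) y).trans_lt (by simp)

lemma lc_ae_interior {n : ℕ} {f : Euc n → ℝ} (hf : IsLogConcaveFn f) :
    ∀ᵐ x ∂(volume.withDensity (fun x => ENNReal.ofReal (f x))), x ∈ interior {x | 0 < f x} := by
  rw [ae_withDensity_iff' (lc_aemeasurable hf).ennreal_ofReal]
  have h2 := (lc_convex hf 0).addHaar_frontier volume
  filter_upwards [measure_eq_zero_iff_ae_notMem.1 h2] with x hx hx0
  by_contra hcon
  apply hx
  refine ⟨subset_closure ?_, hcon⟩
  simpa using hx0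

lemma lc_zero_mem {n : ℕ} {f : Euc n → ℝ} (hf : IsLogConcaveFn f) (μ : Measure (Euc n))
    [IsProbabilityMeasure μ] (hμ : μ = volume.withDensity (fun x => ENNReal.ofReal (f x)))
    (hcent : ∫ x, x ∂μ = 0) (h1 : ∫⁻ x, ENNReal.ofReal (f x) = 1) :
    (0 : Euc n) ∈ interior {x | 0 < f x} := by
  by_contra hcon
  obtain ⟨l, hl⟩ := geometric_hahn_banach_open_point (lc_convex hf 0).interior isOpen_interior hcon
  have hint : Integrable (fun x : Euc n => x) μ := hμ ▸ lc_integrable hf h1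
  have hae := lc_ae_interior hf
  rw [← hμ] at hae
  have h0 : ∫ x, l x ∂μ = 0 := by
    rw [l.integral_comp_comm hint, hcent, map_zero]
  have hneg : ∀ᵐ x ∂μ, l x < 0 := by
    filter_upwards [hae] with x hx
    simpa using hl x hx
  have h3 : ∫ x, - l x ∂μ = 0 := by rw [integral_neg, h0, neg_zero]
  have hli : Integrable (fun x => - l x) μ := (l.integrable_comp hint).neg
  rw [integral_eq_zero_iff_of_nonneg_ae (hneg.mono fun x hx => by simp; exact hx.le) hli] at h3
  have : ∀ᵐ x ∂μ, False := by
    filter_upwards [h3, hneg] with x hx hx'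
    simp at hx
    exact hx'.ne hx
  simp at this
  exact IsProbabilityMeasure.ne_zero μ this

lemma jensen_open {n : ℕ} {U : Set (Euc n)} (hU : IsOpen U) {g : Euc n → ℝ}
    (hg : ConvexOn ℝ U g) (h0 : (0 : Euc n) ∈ U) (μ : Measure (Euc n)) [IsProbabilityMeasure μ]
    (hae : ∀ᵐ x ∂μ, x ∈ U) (hi : Integrable (fun x : Euc n => x) μ) (hgi : Integrable g μ)
    (hcent : ∫ x, x ∂μ = 0) : g 0 ≤ ∫ x, g x ∂μ := by
  have hmem := Convex.integral_mem (μ := μ) (f := fun x => (x, g x)) hg.convex_epigraph.closure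
    isClosed_closure (hae.mono fun x hx => subset_closure ⟨hx, le_rfl⟩) (hi.prodMk hgi)
  rw [integral_pair hi hgi, hcent] at hmem
  by_contra! hlt
  obtain ⟨m, hm1, hm2⟩ := exists_between hlt
  have hcont : ContinuousAt g 0 := (hg.continuousOn hU).continuousAt (hU.mem_nhds h0)
  have hnh : {x | m < g x} ∈ nhds (0 : Euc n) := hcont.eventually (lt_mem_nhds hm2)
  have hnh2 : Iio m ∈ nhds (∫ x, g x ∂μ) := Iio_mem_nhds hm1
  obtain ⟨p, hp, hp2⟩ := mem_closure_iff_nhds.1 hmem _ (prod_mem_nhds hnh hnh2)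
  have a1 : m < g p.1 := hp.1
  have a2 : p.2 < m := hp.2
  have a3 : g p.1 ≤ p.2 := hp2.2
  linarith

lemma lc_convexOn {n : ℕ} {f : Euc n → ℝ} (hf : IsLogConcaveFn f) {s : ℝ} (hs : 0 < s) {k : ℝ}
    (hk : 0 ≤ k) : ConvexOn ℝ (interior {x | 0 < f x}) (fun x => f x ^ (-s) * k) := by
  refine ⟨(lc_convex hf 0).interior, ?_⟩
  intro x hx y hy a b ha hb hab
  have hx0 : 0 < f x := by
    have := interior_subset hx
    exact this
  have hy0 : 0 < f y := by
    have := interior_subset hy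
    exact this
  obtain rfl : b = 1 - a := by linarith
  have h1 := hf.2 x y a ha (by linarith)
  have h2 : f (a • x + (1 - a) • y) ^ (-s) ≤ (f x ^ a * f y ^ (1 - a)) ^ (-s) :=
    Real.rpow_le_rpow_of_nonpos (by positivity) h1 (by linarith)
  have h3 : (f x ^ a * f y ^ (1 - a)) ^ (-s) = (f x ^ (-s)) ^ a * (f y ^ (-s)) ^ (1 - a) := by
    rw [Real.mul_rpow (by positivity) (by positivity), ← Real.rpow_mul hx0.le,
      ← Real.rpow_mul hy0.le, ← Real.rpow_mul hx0.le, ← Real.rpow_mul hy0.le, mul_comm a,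
      mul_comm (1 - a)]
  have h4 := Real.geom_mean_le_arith_mean2_weighted ha hb
    (Real.rpow_nonneg hx0.le (-s)) (Real.rpow_nonneg hy0.le (-s)) hab
  simp only [smul_eq_mul]
  calc f (a • x + (1 - a) • y) ^ (-s) * k ≤ (a * f x ^ (-s) + (1 - a) * f y ^ (-s)) * k := by
        gcongr; exact h2.trans (h3.le.trans h4)
    _ = _ := by ring

lemma lc_frad {n : ℕ} {f : Euc n → ℝ} (hf : IsLogConcaveFn f) (μ : Measure (Euc n))
    [IsProbabilityMeasure μ] (hμ : μ = volume.withDensity (fun x => ENNReal.ofReal (f x)))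
    (hcent : ∫ x, x ∂μ = 0) (h1 : ∫⁻ x, ENNReal.ofReal (f x) = 1) (y : Euc n) (hy : 0 < f y) :
    0 < f 0 ∧ Real.log (f y) - Real.log (f 0) ≤ n := by
  have h0 := lc_zero_mem hf μ hμ hcent h1
  have hf0 : 0 < f 0 := by
    have := interior_subset h0
    exact this
  refine ⟨hf0, ?_⟩
  have hint : Integrable (fun x : Euc n => x) μ := hμ ▸ lc_integrable hf h1
  have hae := lc_ae_interior hf
  rw [← hμ] at hae
  have hm := lc_aemeasurable hf
  set L := Real.log (f y) - Real.log (f 0) with hL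
  have key : ∀ s : ℝ, 0 < s → s < 1 → (1 - s) * L ≤ n := by
    intro s hs hs1
    set g : Euc n → ℝ := fun x => f x ^ (-s) * f y ^ s with hgdef
    have hgm : AEMeasurable g volume := (hm.pow_const _).mul_const _
    have hgn : ∀ x, 0 ≤ g x := fun x => by
      have := hf.1 x
      positivity
    have hlin : ∫⁻ x, ENNReal.ofReal (g x) ∂μ ≤ ENNReal.ofReal (((1 - s) ^ n)⁻¹) := by
      rw [hμ, lintegral_withDensity_eq_lintegral_mul₀ hm.ennreal_ofReal hgm.ennreal_ofReal]
      refine le_trans (lintegral_mono fun x => ?_)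
        (lc_pow_int hf h1 (t := 1 - s) (by linarith) (by linarith) y)
      rw [Pi.mul_apply, ← ENNReal.ofReal_mul (hf.1 x)]
      apply ENNReal.ofReal_le_ofReal
      rcases (hf.1 x).eq_or_lt with hx | hx
      · rw [← hx, zero_mul]
        positivity
      · have e1 : f x ^ (1 - s) = f x * f x ^ (-s) := by
          rw [sub_eq_add_neg, Real.rpow_add hx, Real.rpow_one]
        rw [e1, sub_sub_cancel, hgdef, mul_assoc]
    have hgm' : AEMeasurable g μ := by
      rw [hμ]; exact hgm.mono' (withDensity_absolutelyContinuous _ _)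
    have hgi : Integrable g μ := by
      refine ⟨hgm'.aestronglyMeasurable, ?_⟩
      rw [hasFiniteIntegral_iff_ofReal (Eventually.of_forall hgn)]
      exact hlin.trans_lt (by simp)
    have hpos : 0 < 1 - s := by linarith
    have hI : ∫ x, g x ∂μ ≤ ((1 - s) ^ n)⁻¹ := by
      rw [integral_eq_lintegral_of_nonneg_ae (Eventually.of_forall hgn) hgi.1]
      exact ENNReal.toReal_le_of_le_ofReal (by positivity) hlin
    have hJ := (jensen_open isOpen_interior (lc_convexOn hf hs (k := f y ^ s) (by positivity)) h0 μ
      hae hint hgi hcent).trans hI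
    have hlog := Real.log_le_log (by positivity) hJ
    rw [Real.log_mul (by positivity) (by positivity), Real.log_rpow hf0, Real.log_rpow hy,
      Real.log_inv, Real.log_pow] at hlog
    have h5 := Real.one_sub_inv_le_log_of_pos hpos
    have h6 : s * L ≤ n * ((1 - s)⁻¹ - 1) := by
      have : (n : ℝ) * (1 - (1 - s)⁻¹) ≤ n * Real.log (1 - s) := by gcongr
      rw [hL]
      linarith
    have h7 : (1 - s)⁻¹ - 1 = s * (1 - s)⁻¹ := by field_simp; ring
    rw [h7] at h6
    have h8 : L ≤ n * (1 - s)⁻¹ := by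
      have : s * L ≤ s * (n * (1 - s)⁻¹) := by linarith
      exact le_of_mul_le_mul_left this hs
    calc (1 - s) * L ≤ (1 - s) * (n * (1 - s)⁻¹) := by gcongr
      _ = n := by field_simp
  have ht : Tendsto (fun s : ℝ => (1 - s) * L) (nhdsWithin 0 (Ioi 0)) (nhds ((1 - 0) * L)) := by
    apply Tendsto.mono_left _ nhdsWithin_le_nhds
    exact Continuous.tendsto (by fun_prop) 0
  have := le_of_tendsto ht (b := (n : ℝ)) (by
    filter_upwards [Ioo_mem_nhdsGT (zero_lt_one (α := ℝ))] with s hs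
    exact key s hs.1 hs.2)
  simpa using this

lemma lc_dilate {n : ℕ} {f : Euc n → ℝ} (hf : IsLogConcaveFn f) (μ : Measure (Euc n))
    [IsProbabilityMeasure μ] (hμ : μ = volume.withDensity (fun x => ENNReal.ofReal (f x)))
    (hcent : ∫ x, x ∂μ = 0) (h1 : ∫⁻ x, ENNReal.ofReal (f x) = 1) {δ : ℝ} (hδ : 0 < δ)
    (x : Euc n) : f ((1 + δ) • x) ≤ Real.exp (n * δ) * f x := by
  set y := (1 + δ) • x with hy
  rcases (hf.1 y).eq_or_lt with h0 | h0
  · rw [← h0]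
    have := hf.1 x
    positivity
  obtain ⟨hf0, hL⟩ := lc_frad hf μ hμ hcent h1 y h0
  have hd : 0 < 1 + δ := by linarith
  have h2 := hf.2 y 0 (1 / (1 + δ)) (by positivity) (by rw [div_le_one hd]; linarith)
  have hx : (1 / (1 + δ)) • y + (1 - 1 / (1 + δ)) • (0 : Euc n) = x := by
    rw [hy, smul_smul, smul_zero, add_zero, one_div, inv_mul_cancel₀ hd.ne', one_smul]
  rw [hx] at h2
  have hfx : 0 < f x := lt_of_lt_of_le (by positivity) h2
  have h3 := Real.log_le_log (by positivity) h2
  rw [Real.log_mul (by positivity) (by positivity), Real.log_rpow h0, Real.log_rpow hf0] at h3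
  have h4 : Real.log (f y) ≤ n * δ + Real.log (f x) := by
    have e : (1 - 1 / (1 + δ)) = δ * (1 / (1 + δ)) := by field_simp; ring
    rw [e] at h3
    have h5 : Real.log (f y) + δ * Real.log (f 0) ≤ (1 + δ) * Real.log (f x) := by
      calc _ = (1 + δ) * (1 / (1 + δ) * Real.log (f y) + δ * (1 / (1 + δ)) * Real.log (f 0)) := by
            field_simp
        _ ≤ _ := by gcongr
    by_contra! hcon
    have h6 := mul_le_mul_of_nonneg_left hL hδ.le
    have h7 := mul_lt_mul_of_pos_left hcon hd
    have h8 : 0 ≤ (n : ℝ) * δ * δ := by positivity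
    linarith
  rw [← Real.log_le_log_iff h0 (by positivity), Real.log_mul (Real.exp_pos _).ne' hfx.ne',
    Real.log_exp]
  exact h4

lemma lc_measure_dilate {n : ℕ} {f : Euc n → ℝ} (hf : IsLogConcaveFn f) (μ : Measure (Euc n))
    [IsProbabilityMeasure μ] (hμ : μ = volume.withDensity (fun x => ENNReal.ofReal (f x)))
    (hcent : ∫ x, x ∂μ = 0) (h1 : ∫⁻ x, ENNReal.ofReal (f x) = 1) {δ : ℝ} (hδ : 0 < δ)
    (A : Set (Euc n)) (hA : MeasurableSet A) :
    (μ ((1 + δ) • A)).toReal ≤ Real.exp (2 * n * δ) * (μ A).toReal := by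
  have hd : 0 < 1 + δ := by linarith
  have hmA : MeasurableSet ((1 + δ) • A) := hA.const_smul₀ _
  have h2 := scale_lintegral (fun x => ((1 + δ) • A).indicator (fun x => ENNReal.ofReal (f x)) x)
    hd 0
  rw [lintegral_indicator hmA, ← withDensity_apply _ hmA, ← hμ] at h2
  have h3 : ∫⁻ x, ((1 + δ) • A).indicator (fun x => ENNReal.ofReal (f x)) ((1 + δ) • x + 0) ≤
      ENNReal.ofReal (Real.exp (n * δ)) * μ A := by
    rw [hμ, withDensity_apply _ hA, ← lintegral_const_mul' _ _ (by simp), ← lintegral_indicator hA]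
    refine lintegral_mono fun x => ?_
    rw [add_zero]
    by_cases hx : x ∈ A
    · rw [indicator_of_mem (smul_mem_smul_set hx), indicator_of_mem hx,
        ← ENNReal.ofReal_mul (Real.exp_pos _).le]
      exact ENNReal.ofReal_le_ofReal (lc_dilate hf μ hμ hcent h1 hδ x)
    · rw [indicator_of_notMem]
      · exact zero_le
      · rwa [smul_mem_smul_set_iff₀ hd.ne']
  rw [h2] at h3
  have h4 := ENNReal.toReal_mono (ENNReal.mul_ne_top (by simp) (measure_ne_top μ A)) h3
  rw [ENNReal.toReal_mul, ENNReal.toReal_mul, ENNReal.toReal_ofReal (by positivity),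
    ENNReal.toReal_ofReal (by positivity)] at h4
  have h5 : (1 + δ) ^ n ≤ Real.exp (n * δ) := by
    rw [Real.exp_nat_mul]
    gcongr
    linarith [Real.add_one_le_exp δ]
  calc (μ ((1 + δ) • A)).toReal = (1 + δ) ^ n * (((1 + δ) ^ n)⁻¹ * (μ ((1 + δ) • A)).toReal) := by
        field_simp
    _ ≤ Real.exp (n * δ) * (Real.exp (n * δ) * (μ A).toReal) := by gcongr
    _ = _ := by rw [← mul_assoc, ← Real.exp_add]; ring_nf

theorem perimeter_le_of_ball_subset {n : ℕ} (f : Euc n → ℝ) (μ : Measure (Euc n))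
    [IsProbabilityMeasure μ]
    (hf : IsLogConcaveFn f)
    (hμ : μ = volume.withDensity (fun x => ENNReal.ofReal (f x)))
    (hcent : ∫ x, x ∂μ = 0)
    (A : Set (Euc n)) (hA : IsConvexBody A)
    (r : ℝ) (hr : 0 < r) (hball : closedBall (0 : Euc n) r ⊆ A) :
    muPerim μ A ≤ 2 * n * (μ A).toReal / r := by
  obtain ⟨hconv, hcomp, -⟩ := hA
  have h1 : ∫⁻ x, ENNReal.ofReal (f x) = 1 := by
    have := measure_univ (μ := μ)
    rwa [hμ, withDensity_apply _ MeasurableSet.univ, Measure.restrict_univ] at this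
  have hmA : MeasurableSet A := hcomp.isClosed.measurableSet
  have hbound : ∀ ε : ℝ, 0 < ε → (μ ((A + closedBall (0 : Euc n) ε) \ A)).toReal / ε ≤
      (Real.exp (2 * n * (ε / r)) - 1) / ε * (μ A).toReal := by
    intro ε hε
    have hδ : 0 < ε / r := by positivity
    have hsub0 : closedBall (0 : Euc n) ε ⊆ (ε / r) • A := by
      have : closedBall (0 : Euc n) ε = (ε / r) • closedBall (0 : Euc n) r := by
        rw [smul_closedBall _ _ hr.le, smul_zero, Real.norm_of_nonneg hδ.le, div_mul_cancel₀ _ hr.ne']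
      rw [this]
      exact smul_set_mono hball
    have hsub : A + closedBall (0 : Euc n) ε ⊆ (1 + ε / r) • A := by
      rw [hconv.add_smul zero_le_one hδ.le, one_smul]
      exact add_subset_add_left hsub0
    have hsubA : A ⊆ (1 + ε / r) • A :=
      (fun x hx => hsub ⟨x, hx, 0, by simp [hε.le], add_zero x⟩)
    have h2 : (μ ((A + closedBall (0 : Euc n) ε) \ A)).toReal ≤
        (μ ((1 + ε / r) • A)).toReal - (μ A).toReal := by
      rw [← ENNReal.toReal_sub_of_le (measure_mono hsubA) (measure_ne_top _ _),
        ← measure_sdiff hsubA hmA.nullMeasurableSet (measure_ne_top _ _)]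
      exact ENNReal.toReal_mono (measure_ne_top _ _) (measure_mono (sdiff_subset_sdiff_left hsub))
    have h3 := lc_measure_dilate hf μ hμ hcent h1 hδ A hmA
    rw [div_mul_eq_mul_div]
    gcongr
    linarith
  have hlim : Tendsto (fun ε : ℝ => (Real.exp (2 * n * (ε / r)) - 1) / ε * (μ A).toReal)
      (nhdsWithin 0 (Ioi 0)) (nhds (2 * n * (μ A).toReal / r)) := by
    have hd : HasDerivAt (fun ε : ℝ => Real.exp (2 * n * (ε / r))) (2 * n / r) 0 := by
      have := (((hasDerivAt_id (0 : ℝ)).div_const r).const_mul (2 * (n : ℝ))).exp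
      have e : Real.exp (2 * n * (id 0 / r)) * (2 * n * (1 / r)) = 2 * n / r := by
        simp [div_eq_mul_inv]
      rw [e] at this
      exact this
    have h4 := (hasDerivAt_iff_tendsto_slope_zero.1 hd).mono_left
      (nhdsWithin_mono 0 (fun x (hx : x ∈ Ioi (0 : ℝ)) => (ne_of_gt hx : x ≠ 0)) : nhdsWithin (0 : ℝ) (Ioi 0) ≤ nhdsWithin 0 {0}ᶜ)
    have h5 := h4.mul_const (μ A).toReal
    convert h5 using 1
    · ext ε
      simp [div_eq_inv_mul]
    · congr 1; ring
  have hev : ∀ᶠ ε in nhdsWithin (0 : ℝ) (Ioi 0), 0 ≤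
      (μ ((A + closedBall (0 : Euc n) ε) \ A)).toReal / ε := by
    filter_upwards [self_mem_nhdsWithin] with ε hε
    have : (0 : ℝ) < ε := hε
    positivity
  unfold muPerim
  rw [← hlim.liminf_eq]
  refine liminf_le_liminf ?_ ⟨0, hev⟩ hlim.isCoboundedUnder_ge
  filter_upwards [self_mem_nhdsWithin] with ε hε
  exact hbound ε hε
end
end
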